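/- Let N ≥ 1, T > 0, and let c0, c1 : ℝ^N × [0,T] → ℝ be continuous functions that both satisfy (H1) and (H4), and such that (H5) holds. Let u0 : ℝ^N → ℝ be Lipschitz continuous, semiconvex with some constant, satisfying (H3), and such that {x : u0(x) ≥ 0} is compact. Then there exists exactly one continuous function u : ℝ^N × [0,T] → ℝ such that u is a viscosity solution of u_t = c̄(x,t)|Du| with initial datum u0, where c̄(x,t) = ∫_{ℝ^N} c0(y − x, t)·1_{{z : u(z,t) ≥ 0}}(y) dy + c1(x,t). -/

import Mathlib

open Set MeasureTheory Filter Metric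
open scoped Topology ENNReal NNReal RealInnerProductSpace symmDiff

noncomputable section

/-- Euclidean space ℝ^N. -/
abbrev Euc (N : ℕ) := EuclideanSpace ℝ (Fin N)

/-- The Fréchet superdifferential D⁺v(x): the set of p with
limsup_{y→x} (v(y) − v(x) − ⟨p, y−x⟩)/|y−x| ≤ 0. -/
def SuperDiff {N : ℕ} (v : Euc N → ℝ) (x : Euc N) : Set (Euc N) :=
  {p | ∀ ε > 0, ∀ᶠ y in 𝓝[≠] x, (v y - v x - ⟪p, y - x⟫) / ‖y - x‖ ≤ ε}

/-- Semiconvexity with constant C: v(x+h) − 2v(x) + v(x−h) ≥ −C|h|². -/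
def Semiconvex {N : ℕ} (C : ℝ) (v : Euc N → ℝ) : Prop :=
  ∀ x h : Euc N, v (x + h) - 2 * v x + v (x - h) ≥ -C * ‖h‖ ^ 2

/-- Viscosity solution of u_t = c(x,t)|Du| on ℝ^N × (0,T) with initial datum u0. -/
def IsViscositySolution (N : ℕ) (T : ℝ) (c u : Euc N → ℝ → ℝ) (u0 : Euc N → ℝ) : Prop :=
  (∀ x, u x 0 = u0 x) ∧
  ∀ φ : Euc N → ℝ → ℝ,
    ContDiff ℝ 1 (fun p : Euc N × ℝ => φ p.1 p.2) →
    ∀ x0 : Euc N, ∀ t0 ∈ Set.Ioo 0 T,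
      (IsLocalMaxOn (fun p : Euc N × ℝ => u p.1 p.2 - φ p.1 p.2)
          (Set.univ ×ˢ Set.Icc 0 T) (x0, t0) →
        deriv (φ x0) t0 ≤ c x0 t0 * ‖gradient (fun x => φ x t0) x0‖) ∧
      (IsLocalMinOn (fun p : Euc N × ℝ => u p.1 p.2 - φ p.1 p.2)
          (Set.univ ×ˢ Set.Icc 0 T) (x0, t0) →
        deriv (φ x0) t0 ≥ c x0 t0 * ‖gradient (fun x => φ x t0) x0‖)

namespace Dislocation

variable {N : ℕ}

/-- `w` is Lipschitz with constant `K` (one-sided form, equivalent by symmetry). -/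
def LipBound (K : ℝ) (w : Euc N → ℝ) : Prop := ∀ x y, w x - w y ≤ K * ‖x - y‖

lemma LipBound.abs_le {K : ℝ} {w : Euc N → ℝ} (h : LipBound K w) (x y : Euc N) :
    |w x - w y| ≤ K * ‖x - y‖ := by
  have h1 := h x y
  have h2 := h y x
  rw [norm_sub_rev] at h2
  exact _root_.abs_le.2 ⟨by linarith, h1⟩

lemma LipBound.mono {K K' : ℝ} {w : Euc N → ℝ} (h : LipBound K w) (hK : K ≤ K') :
    LipBound K' w := fun x y =>
  (h x y).trans (mul_le_mul_of_nonneg_right hK (norm_nonneg _))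

lemma LipBound.lipschitzWith {K : ℝ} {w : Euc N → ℝ} (h : LipBound K w) :
    LipschitzWith K.toNNReal w := by
  apply LipschitzWith.of_dist_le_mul
  intro x y
  rw [Real.dist_eq, dist_eq_norm]
  exact (h.abs_le x y).trans
    (mul_le_mul_of_nonneg_right (Real.le_coe_toNNReal K) (norm_nonneg _))

lemma LipBound.continuous {K : ℝ} {w : Euc N → ℝ} (h : LipBound K w) : Continuous w :=
  h.lipschitzWith.continuous

/-- The ascending slope of `w` is at least `η` at every point where `|w| < δ`. -/
def SlopeGE (η δ : ℝ) (w : Euc N → ℝ) : Prop :=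
  ∀ x, |w x| < δ → ∀ ρ > 0, ∃ y, 0 < ‖y - x‖ ∧ ‖y - x‖ < ρ ∧ w x + η * ‖y - x‖ ≤ w y

/-- One step of the Hopf-type scheme: maximise `w` over the ball of radius `r x`. -/
def hopf (r : Euc N → ℝ) (w : Euc N → ℝ) (x : Euc N) : ℝ :=
  sSup (w '' closedBall x (r x))

lemma hopf_exists {r w : Euc N → ℝ} (hw : Continuous w) {x : Euc N} (hr : 0 ≤ r x) :
    ∃ y, ‖y - x‖ ≤ r x ∧ hopf r w x = w y := by
  obtain ⟨y, hy, h⟩ := (isCompact_closedBall x (r x)).exists_sSup_image_eq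
    ⟨x, mem_closedBall_self hr⟩ hw.continuousOn
  exact ⟨y, by simpa [dist_eq_norm] using hy, h⟩

lemma le_hopf {r w : Euc N → ℝ} (hw : Continuous w) {x y : Euc N} (hy : ‖y - x‖ ≤ r x) :
    w y ≤ hopf r w x := by
  apply le_csSup ((isCompact_closedBall x (r x)).bddAbove_image hw.continuousOn)
  exact ⟨y, by simpa [dist_eq_norm] using hy, rfl⟩

/-- Polar decomposition of a displacement of length at most `a`. -/
lemma exists_smul_eq {d : Euc N} {a : ℝ} (hd : ‖d‖ ≤ a) :
    ∃ b : Euc N, ‖b‖ ≤ 1 ∧ d = a • b := by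
  rcases (norm_nonneg d).trans hd |>.eq_or_lt with h | h
  · refine ⟨0, by simp, ?_⟩
    have : ‖d‖ = 0 := le_antisymm (h ▸ hd) (norm_nonneg _)
    simpa using this
  · refine ⟨a⁻¹ • d, ?_, ?_⟩
    · rw [norm_smul, Real.norm_of_nonneg (by positivity), inv_mul_le_iff₀ h]; simpa using hd
    · rw [smul_smul, mul_inv_cancel₀ h.ne', one_smul]

lemma hopf_lipBound {r w : Euc N → ℝ} {K l : ℝ} (hK : 0 ≤ K) (hw : LipBound K w)
    (hr : ∀ x, 0 ≤ r x) (hl : LipBound l r) : LipBound (K * (1 + l)) (hopf r w) := by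
  intro x x'
  obtain ⟨y, hy, he⟩ := hopf_exists hw.continuous (hr x)
  obtain ⟨b, hb, hyb⟩ := exists_smul_eq hy
  have h1 : w (x' + r x' • b) ≤ hopf r w x' := by
    apply le_hopf hw.continuous
    rw [add_sub_cancel_left, norm_smul, Real.norm_of_nonneg (hr _)]
    exact mul_le_of_le_one_right (hr _) hb
  have h2 : w y - w (x' + r x' • b) ≤ K * ‖y - (x' + r x' • b)‖ := hw _ _
  have h3 : y - (x' + r x' • b) = (x - x') + (r x - r x') • b := by
    rw [sub_smul, ← hyb]; abel
  have h4 : ‖y - (x' + r x' • b)‖ ≤ (1 + l) * ‖x - x'‖ := by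
    rw [h3]
    calc _ ≤ ‖x - x'‖ + |r x - r x'| * ‖b‖ := by
          refine (norm_add_le _ _).trans ?_
          rw [norm_smul, Real.norm_eq_abs]
      _ ≤ ‖x - x'‖ + |r x - r x'| * 1 := by gcongr
      _ ≤ _ := by have := hl.abs_le x x'; linarith
  have h5 := mul_le_mul_of_nonneg_left h4 hK
  rw [he]; linarith

lemma hopf_semiconvex {r w : Euc N → ℝ} {K l lam C : ℝ} (hK : 0 ≤ K) (hC : 0 ≤ C)
    (hlam : 0 ≤ lam)
    (hw : LipBound K w) (hr : ∀ x, 0 ≤ r x) (hl : LipBound l r)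
    (hsr : Semiconvex lam r) (hsw : Semiconvex C w) :
    Semiconvex (C * (1 + l) ^ 2 + K * lam) (hopf r w) := by
  intro x h
  obtain ⟨y, hy, he⟩ := hopf_exists hw.continuous (hr x)
  obtain ⟨b, hb, hyb⟩ := exists_smul_eq hy
  have hrp := hr (x + h)
  have hrm := hr (x - h)
  have hr0 := hr x
  have hs := hsr x h
  have hlx := hl.abs_le (x + h) x
  rw [add_sub_cancel_left] at hlx
  have hln : 0 ≤ lam * ‖h‖ ^ 2 := by positivity
  obtain ⟨m, hm0, hm1, hm2, hm3⟩ : ∃ m, 0 ≤ m ∧ m ≤ r (x + h) ∧ m ≤ 2 * r x ∧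
      (2 * r x - m ≤ r (x - h) + lam * ‖h‖ ^ 2 ∧ |m - r x| ≤ l * ‖h‖) := by
    rcases le_total (r (x + h)) (2 * r x) with h' | h'
    · exact ⟨r (x + h), hrp, le_rfl, h', by linarith, hlx⟩
    · refine ⟨2 * r x, by linarith, h', le_rfl, by linarith, ?_⟩
      rw [abs_le] at hlx ⊢
      constructor <;> linarith
  set q := min (2 * r x - m) (r (x - h)) with hq
  have hq0 : 0 ≤ q := le_min (by linarith) hrm
  have h1 : w (x + h + m • b) ≤ hopf r w (x + h) := by
    apply le_hopf hw.continuous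
    rw [add_sub_cancel_left, norm_smul, Real.norm_of_nonneg hm0]
    exact (mul_le_of_le_one_right hm0 hb).trans hm1
  have h2 : w (x - h + q • b) ≤ hopf r w (x - h) := by
    apply le_hopf hw.continuous
    rw [add_sub_cancel_left, norm_smul, Real.norm_of_nonneg hq0]
    exact (mul_le_of_le_one_right hq0 hb).trans (min_le_right _ _)
  have hqd : |(2 * r x - m) - q| ≤ lam * ‖h‖ ^ 2 := by
    rcases le_total (2 * r x - m) (r (x - h)) with h' | h'
    · rw [hq, min_eq_left h', sub_self, abs_zero]; exact hln
    · rw [hq, min_eq_right h', abs_of_nonneg (by linarith)]; linarith [hm3.1]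
  have h3 : w (x - h + (2 * r x - m) • b) - w (x - h + q • b) ≤ K * (lam * ‖h‖ ^ 2) := by
    refine (hw _ _).trans (mul_le_mul_of_nonneg_left ?_ hK)
    rw [add_sub_add_left_eq_sub, ← sub_smul, norm_smul, Real.norm_eq_abs]
    exact (mul_le_of_le_one_right (abs_nonneg _) hb).trans hqd
  have h4 := hsw y (h + (m - r x) • b)
  have e1 : y + (h + (m - r x) • b) = x + h + m • b := by
    rw [sub_smul, ← hyb]; abel
  have e2 : y - (h + (m - r x) • b) = x - h + (2 * r x - m) • b := by
    have : y = x + r x • b := by rw [← hyb]; abel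
    rw [this]; module
  have h5 : ‖h + (m - r x) • b‖ ≤ (1 + l) * ‖h‖ := by
    refine (norm_add_le _ _).trans ?_
    rw [norm_smul, Real.norm_eq_abs]
    have := mul_le_of_le_one_right (abs_nonneg (m - r x)) hb
    linarith [hm3.2]
  have h6 : C * ‖h + (m - r x) • b‖ ^ 2 ≤ C * ((1 + l) * ‖h‖) ^ 2 := by gcongr
  rw [e1, e2] at h4
  rw [he]
  nlinarith

lemma hopf_slope {r w : Euc N → ℝ} {l η δ K : ℝ} (hw : LipBound K w) (hη : 0 < η) (hl0 : 0 ≤ l)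
    (hl1 : l < 1) (hr : ∀ x, 0 ≤ r x) (hl : LipBound l r) (hs : SlopeGE η δ w) :
    SlopeGE (η * (1 - l)) δ (hopf r w) := by
  intro x hx ρ hρ
  obtain ⟨y, hy, he⟩ := hopf_exists hw.continuous (hr x)
  obtain ⟨b, hb, hyb⟩ := exists_smul_eq hy
  obtain ⟨y', hy0, hyρ, hyw⟩ := hs y (he ▸ hx) (ρ * (1 - l)) (mul_pos hρ (by linarith))
  have hc : ContractingWith l.toNNReal (fun z => y' - r z • b) := by
    refine ⟨by rwa [Real.toNNReal_lt_one], LipschitzWith.of_dist_le_mul fun z z' => ?_⟩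
    rw [dist_eq_norm, dist_eq_norm, Real.coe_toNNReal _ hl0, sub_sub_sub_cancel_left, ← sub_smul,
      norm_smul, Real.norm_eq_abs, norm_sub_rev z z']
    exact (mul_le_of_le_one_right (abs_nonneg _) hb).trans (hl.abs_le _ _)
  set x' := hc.fixedPoint with hx'
  have hfix : y' - r x' • b = x' := hc.fixedPoint_isFixedPt
  have hd : x' - x = (y' - y) - (r x' - r x) • b := by
    have h1 : y = x + r x • b := by rw [← hyb]; abel
    rw [h1]; nth_rewrite 1 [← hfix]; module
  have hd1 : ‖x' - x‖ ≤ ‖y' - y‖ + l * ‖x' - x‖ := by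
    nth_rewrite 1 [hd]
    refine (norm_sub_le _ _).trans ?_
    rw [norm_smul, Real.norm_eq_abs]
    have := mul_le_of_le_one_right (abs_nonneg (r x' - r x)) hb
    linarith [hl.abs_le x' x]
  have hup : w y' ≤ hopf r w x' := by
    apply le_hopf hw.continuous
    have : y' - x' = r x' • b := by nth_rewrite 1 [← hfix]; abel
    rw [this, norm_smul, Real.norm_of_nonneg (hr _)]
    exact mul_le_of_le_one_right (hr _) hb
  refine ⟨x', ?_, ?_, ?_⟩
  · rw [norm_pos_iff, sub_ne_zero]
    intro hxx
    rw [hxx, sub_self, sub_self, zero_smul, sub_zero] at hd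
    rw [← hd, norm_zero] at hy0
    exact hy0.false
  · have : (1 - l) * ‖x' - x‖ < (1 - l) * ρ := by nlinarith
    exact lt_of_mul_lt_mul_left this (by linarith)
  · rw [he]
    nlinarith

/-- A sequence generated by Hopf steps whose radii are bounded, Lipschitz and semiconvex. -/
structure IsScheme (u r : ℕ → Euc N → ℝ) (ρ l lam : ℝ) : Prop where
  step : ∀ k, u (k + 1) = hopf (r k) (u k)
  nonneg : ∀ k x, 0 ≤ r k x
  le : ∀ k x, r k x ≤ ρ
  lip : ∀ k, LipBound l (r k)
  semi : ∀ k, Semiconvex lam (r k)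

namespace IsScheme

variable {u r : ℕ → Euc N → ℝ} {ρ l lam K C η δ : ℝ}

lemma lipBound (h : IsScheme u r ρ l lam) (hl : 0 ≤ l) (hK : 0 ≤ K) (h0 : LipBound K (u 0))
    (k : ℕ) : LipBound (K * (1 + l) ^ k) (u k) := by
  induction k with
  | zero => simpa using h0
  | succ k ih =>
    rw [h.step, pow_succ, ← mul_assoc]
    exact hopf_lipBound (by positivity) ih (h.nonneg k) (h.lip k)

lemma lipBound_of_le (h : IsScheme u r ρ l lam) (hl : 0 ≤ l) (hK : 0 ≤ K) (h0 : LipBound K (u 0))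
    {n k : ℕ} (hk : k ≤ n) : LipBound (K * (1 + l) ^ n) (u k) :=
  (h.lipBound hl hK h0 k).mono
    (mul_le_mul_of_nonneg_left (pow_le_pow_right₀ (by linarith) hk) hK)

lemma semiconvex (h : IsScheme u r ρ l lam) (hl : 0 ≤ l) (hlam : 0 ≤ lam) (hK : 0 ≤ K)
    (hC : 0 ≤ C) (h0 : LipBound K (u 0)) (hC0 : Semiconvex C (u 0)) {n : ℕ} :
    ∀ k ≤ n, Semiconvex ((1 + l) ^ (2 * k) * (C + K * (1 + l) ^ n * lam * k)) (u k) := by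
  intro k
  induction k with
  | zero => intro _; simpa using hC0
  | succ k ih =>
    intro hk
    have h1 := hopf_semiconvex (by positivity) (by positivity) hlam
      (h.lipBound_of_le hl hK h0 (n := n) (by omega)) (h.nonneg k) (h.lip k) (h.semi k)
      (ih (by omega))
    rw [← h.step] at h1
    intro x y
    refine le_trans ?_ (h1 x y)
    have h2 : 1 ≤ (1 + l) ^ (2 * (k + 1)) := one_le_pow₀ (by linarith)
    have h3 : 0 ≤ K * (1 + l) ^ n * lam := by positivity
    have h4 : (1 + l) ^ (2 * k) * (C + K * (1 + l) ^ n * lam * k) * (1 + l) ^ 2 +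
        K * (1 + l) ^ n * lam ≤
        (1 + l) ^ (2 * (k + 1)) * (C + K * (1 + l) ^ n * lam * ((k + 1 : ℕ) : ℝ)) := by
      push_cast
      have : (1 + l) ^ (2 * (k + 1)) = (1 + l) ^ (2 * k) * (1 + l) ^ 2 := by ring
      rw [this] at h2 ⊢
      nlinarith
    have h5 := mul_le_mul_of_nonneg_right h4 (sq_nonneg ‖y‖)
    linarith

lemma slopeGE (h : IsScheme u r ρ l lam) (hl : 0 ≤ l) (hl1 : l < 1) (hK : 0 ≤ K) (hη : 0 < η)
    (h0 : LipBound K (u 0)) (hs : SlopeGE η δ (u 0)) (k : ℕ) :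
    SlopeGE (η * (1 - l) ^ k) δ (u k) := by
  induction k with
  | zero => simpa using hs
  | succ k ih =>
    rw [h.step, pow_succ, ← mul_assoc]
    exact hopf_slope (h.lipBound hl hK h0 k) (mul_pos hη (pow_pos (by linarith) _)) hl hl1
      (h.nonneg k) (h.lip k) ih

lemma exists_reach (h : IsScheme u r ρ l lam) (hc : ∀ k, Continuous (u k)) (k : ℕ) :
    ∀ x, ∃ y, ‖y - x‖ ≤ k * ρ ∧ u k x = u 0 y := by
  induction k with
  | zero => intro x; exact ⟨x, by simp, rfl⟩
  | succ k ih =>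
    intro x
    obtain ⟨y, hy, he⟩ := hopf_exists (hc k) (h.nonneg k x)
    obtain ⟨z, hz, hez⟩ := ih y
    refine ⟨z, ?_, by rw [h.step, he, hez]⟩
    have := norm_sub_le_norm_sub_add_norm_sub z y x
    push_cast
    linarith [h.le k x]

lemma le_succ (h : IsScheme u r ρ l lam) (hc : ∀ k, Continuous (u k)) (k : ℕ) (x : Euc N) :
    u k x ≤ u (k + 1) x := by
  rw [h.step]
  exact le_hopf (hc k) (by simpa using h.nonneg k x)

lemma succ_le (h : IsScheme u r ρ l lam) (hK : 0 ≤ K) {k : ℕ} (hk : LipBound K (u k))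
    (x : Euc N) : u (k + 1) x ≤ u k x + K * ρ := by
  rw [h.step]
  obtain ⟨y, hy, he⟩ := hopf_exists hk.continuous (h.nonneg k x)
  rw [he]
  have := hk y x
  have := mul_le_mul_of_nonneg_left (hy.trans (h.le k x)) hK
  linarith

lemma time_bound (h : IsScheme u r ρ l lam) (hK : 0 ≤ K) {n : ℕ}
    (hk : ∀ k ≤ n, LipBound K (u k)) (hc : ∀ k, Continuous (u k)) (x : Euc N) (k m : ℕ)
    (hm : k + m ≤ n) : u k x ≤ u (k + m) x ∧ u (k + m) x ≤ u k x + K * (ρ * m) := by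
  induction m with
  | zero => simp
  | succ m ih =>
    have h1 := ih (by omega)
    have h2 := h.le_succ hc (k + m) x
    have h3 := h.succ_le hK (hk (k + m) (by omega)) x
    rw [← add_assoc]
    push_cast
    constructor <;> linarith

lemma exists_back (h : IsScheme u r ρ l lam) (hc : ∀ k, Continuous (u k)) {γ : ℝ} (hγ : 0 ≤ γ)
    (k m : ℕ) : ∀ x0, (∀ j, k ≤ j → j < k + m → ∀ x, ‖x - x0‖ ≤ m * γ → r j x ≤ γ) →
      ∃ y, ‖y - x0‖ ≤ m * γ ∧ u (k + m) x0 = u k y := by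
  induction m with
  | zero => intro x _; exact ⟨x, by simp, rfl⟩
  | succ m ih =>
    intro x hx
    obtain ⟨y, hy, he⟩ := hopf_exists (hc (k + m)) (h.nonneg (k + m) x)
    have hyγ := hy.trans (hx (k + m) (by omega) (by omega) x (by simp; positivity))
    obtain ⟨z, hz, hez⟩ := ih y (fun j hj hj' x' hx' => hx j hj (by omega) x' (by
      have := norm_sub_le_norm_sub_add_norm_sub x' y x
      push_cast; linarith))
    refine ⟨z, ?_, by rw [← add_assoc, h.step, he, hez]⟩
    have := norm_sub_le_norm_sub_add_norm_sub z y x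
    push_cast
    linarith

lemma le_forward (h : IsScheme u r ρ l lam) (hc : ∀ k, Continuous (u k)) {γ : ℝ} (hγ : 0 ≤ γ)
    (k m : ℕ) : ∀ x0, (∀ j, k ≤ j → j < k + m → ∀ x, ‖x - x0‖ ≤ m * γ → γ ≤ r j x) →
      ∀ y, ‖y - x0‖ ≤ m * γ → u k y ≤ u (k + m) x0 := by
  induction m with
  | zero =>
    intro x _ y hy
    have : y = x := by simpa [sub_eq_zero] using hy
    simp [this]
  | succ m ih =>
    intro x hx y hy
    have hm : (0 : ℝ) < (m : ℝ) + 1 := by positivity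
    push_cast at hy
    set z := x + (1 / ((m : ℝ) + 1)) • (y - x) with hz
    have h1 : ‖z - x‖ ≤ γ := by
      rw [hz, add_sub_cancel_left, norm_smul, Real.norm_of_nonneg (by positivity),
        one_div_mul_eq_div, div_le_iff₀ hm]
      linarith
    have h2 : ‖y - z‖ ≤ m * γ := by
      have : y - z = ((m : ℝ) / ((m : ℝ) + 1)) • (y - x) := by
        have e : (m : ℝ) / ((m : ℝ) + 1) = 1 - 1 / ((m : ℝ) + 1) := by field_simp; ring
        rw [hz, e, sub_smul, one_smul]; abel
      rw [this, norm_smul, Real.norm_of_nonneg (by positivity), div_mul_eq_mul_div,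
        div_le_iff₀ hm]
      nlinarith [(Nat.cast_nonneg m : (0 : ℝ) ≤ m)]
    have h3 := ih z (fun j hj hj' x' hx' => hx j hj (by omega) x' (by
      have := norm_sub_le_norm_sub_add_norm_sub x' z x
      push_cast; linarith)) y h2
    refine h3.trans ?_
    rw [← add_assoc, h.step]
    refine le_hopf (hc _) (h1.trans (hx (k + m) (by omega) (by omega) x (by simp; positivity)))

end IsScheme

lemma semiconvex_multiples {w : Euc N → ℝ} {C : ℝ} (hC : Semiconvex C w) (x h : Euc N) (m : ℕ) :
    w (x + (m : ℝ) • h) ≥ w x + m * (w (x + h) - w x) - C * (m * (m - 1) / 2) * ‖h‖ ^ 2 ∧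
      w (x + ((m : ℝ) + 1) • h) - w (x + (m : ℝ) • h) ≥ w (x + h) - w x - m * C * ‖h‖ ^ 2 := by
  induction m with
  | zero => simp
  | succ m ih =>
    have h1 := hC (x + ((m : ℝ) + 1) • h) h
    have e1 : x + ((m : ℝ) + 1) • h + h = x + ((m : ℝ) + 1 + 1) • h := by module
    have e2 : x + ((m : ℝ) + 1) • h - h = x + (m : ℝ) • h := by module
    rw [e1, e2] at h1
    push_cast
    constructor <;> nlinarith [ih.1, ih.2]

/-- A lower bound on the ascending slope of a semiconvex function propagates to unit scale. -/
lemma exists_direction {w : Euc N → ℝ} {C K η : ℝ} (hC0 : 0 ≤ C) (hK0 : 0 ≤ K) (hη : 0 < η)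
    (hC : Semiconvex C w) (hK : LipBound K w) {x : Euc N}
    (hs : ∀ ρ > 0, ∃ y, 0 < ‖y - x‖ ∧ ‖y - x‖ < ρ ∧ w x + η * ‖y - x‖ ≤ w y)
    {ε : ℝ} (hε : 0 < ε) :
    ∃ e : Euc N, ‖e‖ ≤ 1 ∧ ∀ s ∈ Icc (0 : ℝ) 1,
      w x + η * s - C * s ^ 2 / 2 - ε ≤ w (x + s • e) := by
  obtain ⟨y, hy0, hyρ, hy⟩ := hs (ε / (η + K)) (by positivity)
  set r := ‖y - x‖ with hr
  rw [lt_div_iff₀ (by positivity)] at hyρ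
  refine ⟨r⁻¹ • (y - x), ?_, ?_⟩
  · rw [norm_smul, norm_inv, norm_norm, inv_mul_cancel₀ hy0.ne']
  intro s hs
  set m := ⌊s / r⌋₊ with hm
  have hm1 : (m : ℝ) * r ≤ s := by
    rw [← le_div_iff₀ hy0]; exact Nat.floor_le (div_nonneg hs.1 hy0.le)
  have hm2 : s < (m : ℝ) * r + r := by
    have := Nat.lt_floor_add_one (s / r)
    rw [div_lt_iff₀ hy0] at this
    linarith
  have h1 := (semiconvex_multiples hC x (y - x) m).1
  rw [add_sub_cancel, ← hr] at h1
  have h2 := hK (x + (m : ℝ) • (y - x)) (x + s • r⁻¹ • (y - x))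
  have h3 : ‖x + (m : ℝ) • (y - x) - (x + s • r⁻¹ • (y - x))‖ ≤ r := by
    have : x + (m : ℝ) • (y - x) - (x + s • r⁻¹ • (y - x)) = (m - s * r⁻¹) • (y - x) := by module
    have habs : |(m : ℝ) - s * r⁻¹| * r = |(m : ℝ) * r - s| := by
      nth_rewrite 2 [← abs_of_pos hy0]
      rw [← abs_mul, sub_mul, mul_assoc, inv_mul_cancel₀ hy0.ne', mul_one]
    rw [this, norm_smul, ← hr, Real.norm_eq_abs, habs, abs_le]
    constructor <;> linarith
  have h4 := mul_le_mul_of_nonneg_left h3 hK0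
  have h5 : C * (m * (m - 1) / 2) * r ^ 2 ≤ C * s ^ 2 / 2 := by
    have h6 : ((m : ℝ) * r) ^ 2 ≤ s ^ 2 := by gcongr
    have h7 : (m : ℝ) * (m - 1) * r ^ 2 ≤ s ^ 2 := by
      nlinarith [(Nat.cast_nonneg m : (0 : ℝ) ≤ m), sq_nonneg r]
    nlinarith
  have h6 : (m : ℝ) * (η * r) ≤ m * (w y - w x) := by
    apply mul_le_mul_of_nonneg_left _ (Nat.cast_nonneg m); linarith
  nlinarith

lemma exists_ascent_of_differentiableAt {u : Euc N → ℝ} {η : ℝ} (hη : 0 < η) {x : Euc N}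
    (hd : DifferentiableAt ℝ u x) (hp : ∀ p ∈ SuperDiff u x, 2 * η ≤ ‖p‖) :
    ∀ ρ > 0, ∃ y, 0 < ‖y - x‖ ∧ ‖y - x‖ < ρ ∧ u x + η * ‖y - x‖ ≤ u y := by
  intro ρ hρ
  set p := gradient u x with hpdef
  have hg : ∀ c > 0, ∀ᶠ y in 𝓝 x, |u y - u x - ⟪p, y - x⟫| ≤ c * ‖y - x‖ := by
    intro c hc
    have := (hasGradientAt_iff_isLittleO.1 hd.hasGradientAt).def hc
    filter_upwards [this] with y hy
    simpa only [Real.norm_eq_abs] using hy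
  have hpS : 2 * η ≤ ‖p‖ := by
    apply hp
    intro ε hε
    filter_upwards [(hg ε hε).filter_mono nhdsWithin_le_nhds, self_mem_nhdsWithin] with y hy hyx
    have : 0 < ‖y - x‖ := norm_pos_iff.2 (sub_ne_zero.2 hyx)
    rw [div_le_iff₀ this]
    exact (le_abs_self _).trans hy
  have hp0 : 0 < ‖p‖ := by linarith
  obtain ⟨d, hd0, hball⟩ := Metric.eventually_nhds_iff.1 (hg η hη)
  set t := min ρ d / (2 * ‖p‖) with ht
  have hm : 0 < min ρ d := lt_min hρ hd0
  have ht0 : 0 < t := by positivity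
  have htp : t * ‖p‖ = min ρ d / 2 := by rw [ht]; field_simp
  have hn : ‖x + t • p - x‖ = min ρ d / 2 := by
    rw [add_sub_cancel_left, norm_smul, Real.norm_of_nonneg ht0.le, htp]
  refine ⟨x + t • p, by rw [hn]; positivity, ?_, ?_⟩
  · rw [hn]; linarith [min_le_left ρ d]
  · have h1 := hball (y := x + t • p) (by rw [dist_eq_norm, hn]; linarith [min_le_right ρ d])
    rw [hn, add_sub_cancel_left, real_inner_smul_right, real_inner_self_eq_norm_sq] at h1
    rw [hn]
    have h2 : t * ‖p‖ ^ 2 = min ρ d / 2 * ‖p‖ := by rw [← htp]; ring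
    rw [h2] at h1
    have h3 := (abs_le.1 h1).1
    nlinarith

/-- The lower gradient bound for the initial datum, in terms of the ascending slope. -/
lemma slopeGE_of_superDiff {u : Euc N → ℝ} {K C η : ℝ} (hK0 : 0 ≤ K) (hC0 : 0 ≤ C) (hη : 0 < η)
    (hK : LipBound K u) (hC : Semiconvex C u)
    (hH : ∀ x, ∀ p ∈ SuperDiff u x, η ≤ |u x| + ‖p‖) : SlopeGE (η / 8) (η / 2) u := by
  intro x hx ρ hρ
  obtain ⟨s, hs0, hs1, hsρ, hsC⟩ : ∃ s : ℝ, 0 < s ∧ s ≤ 1 ∧ s ≤ ρ / 2 ∧ C * s ≤ η / 16 := by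
    refine ⟨min 1 (min (ρ / 2) (η / (16 * (C + 1)))), by positivity, min_le_left _ _,
      (min_le_right _ _).trans (min_le_left _ _), ?_⟩
    have : min 1 (min (ρ / 2) (η / (16 * (C + 1)))) ≤ η / (16 * (C + 1)) :=
      (min_le_right _ _).trans (min_le_right _ _)
    calc C * _ ≤ (C + 1) * (η / (16 * (C + 1))) := by gcongr; linarith
      _ = η / 16 := by field_simp
  obtain ⟨d, hd0, hds, hdK⟩ : ∃ d : ℝ, 0 < d ∧ d < s ∧ (K + η / 8) * d ≤ η * s / 32 := by
    refine ⟨min (s / 2) (η * s / 32 / (K + η / 8)), by positivity,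
      (min_le_left _ _).trans_lt (by linarith), ?_⟩
    calc _ ≤ (K + η / 8) * (η * s / 32 / (K + η / 8)) := by gcongr; exact min_le_right _ _
      _ = _ := by field_simp
  have hdense : Dense {y | DifferentiableAt ℝ u y} :=
    Measure.dense_of_ae (hK.lipschitzWith.ae_differentiableAt (μ := volume))
  have hopen : IsOpen ({y | |u y| < η / 2} ∩ ball x d) :=
    (isOpen_lt hK.continuous.abs continuous_const).inter isOpen_ball
  obtain ⟨z, ⟨hz, hzd⟩, hzdiff⟩ :=
    hdense.inter_open_nonempty _ hopen ⟨x, hx, mem_ball_self hd0⟩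
  rw [mem_ball, dist_eq_norm] at hzd
  obtain ⟨e, he, hes⟩ := exists_direction hC0 hK0 (by positivity : 0 < η / 4) hC hK
    (exists_ascent_of_differentiableAt (by positivity) hzdiff (fun p hp => by
      have := hH z p hp
      have hz' : |u z| < η / 2 := hz
      linarith)) (by positivity : 0 < η * s / 32)
  have h1 := hes s ⟨hs0.le, hs1⟩
  have h2 := (hK.abs_le z x)
  have h3 : K * ‖z - x‖ ≤ K * d := by gcongr
  have hn : ‖z + s • e - x‖ ≤ s + d := by
    have : z + s • e - x = s • e + (z - x) := by abel
    rw [this]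
    refine (norm_add_le _ _).trans ?_
    rw [norm_smul, Real.norm_of_nonneg hs0.le]
    nlinarith
  have hmain : u x + η / 8 * (s + d) < u (z + s • e) := by
    have h4 := (abs_le.1 h2).1
    have h5 : C * s ^ 2 / 2 ≤ η / 16 * s / 2 := by
      have : C * s ^ 2 = C * s * s := by ring
      rw [this]; gcongr
    nlinarith
  refine ⟨z + s • e, ?_, by linarith, ?_⟩
  · rw [norm_pos_iff, sub_ne_zero]
    intro h
    rw [h] at hmain
    have : 0 < η / 8 * (s + d) := by positivity
    linarith
  · have : η / 8 * ‖z + s • e - x‖ ≤ η / 8 * (s + d) := by gcongr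
    linarith

/-- Volume of a thin set from which `u` increases linearly in a fixed direction. -/
lemma volume_le_of_increasing {u : Euc N → ℝ} {R δ η s0 : ℝ}
    (hδ : 0 < δ) (hη : 0 < η) (hs0 : 0 < s0) {e : Euc N} (he : ‖e‖ ≤ 1) {A : Set (Euc N)}
    (hA : MeasurableSet A) (hAR : A ⊆ closedBall 0 R) (hAδ : ∀ x ∈ A, |u x| ≤ δ)
    (hAe : ∀ x ∈ A, ∀ s ∈ Icc 0 s0, u x + η * s - δ ≤ u (x + s • e)) :
    volume.real A ≤ 4 * δ / η / s0 * volume.real (closedBall (0 : Euc N) (R + s0)) := by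
  set τ := 4 * δ / η with hτ
  have hτ0 : 0 < τ := by positivity
  have hητ : η * τ = 4 * δ := by rw [hτ]; field_simp
  set n := ⌊s0 / τ⌋₊ with hn
  have hn1 : (n : ℝ) * τ ≤ s0 := by
    rw [← le_div_iff₀ hτ0]; exact Nat.floor_le (by positivity)
  have hn2 : s0 ≤ ((n : ℝ) + 1) * τ := by
    have := (Nat.lt_floor_add_one (s0 / τ)).le
    rwa [div_le_iff₀ hτ0] at this
  set B : ℕ → Set (Euc N) := fun k => (fun x => x + (-((k : ℝ) * τ)) • e) ⁻¹' A with hB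
  have hBm : ∀ k, MeasurableSet (B k) := fun k => hA.preimage (measurable_add_const _)
  have hBv : ∀ k, volume (B k) = volume A := fun k => measure_preimage_add_right _ _ _
  have key : ∀ k k' : ℕ, k < k' → k' ≤ n → ∀ x, x ∈ B k → x ∈ B k' → False := by
    intro k k' hkk hk' x hx hx'
    have h1 : (1 : ℝ) ≤ (k' : ℝ) - k := by
      have : (k : ℝ) + 1 ≤ k' := by exact_mod_cast hkk
      linarith
    have h2 : (k' : ℝ) - k ≤ n := by
      have : (k' : ℝ) ≤ n := by exact_mod_cast hk'
      linarith [(Nat.cast_nonneg k : (0 : ℝ) ≤ k)]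
    have h3 := hAe _ hx' (((k' : ℝ) - k) * τ) ⟨by nlinarith, by nlinarith⟩
    have e1 : x + (-((k' : ℝ) * τ)) • e + (((k' : ℝ) - k) * τ) • e
        = x + (-((k : ℝ) * τ)) • e := by module
    simp only [e1] at h3
    have h4 := (abs_le.1 (hAδ _ hx)).2
    have h5 := (abs_le.1 (hAδ _ hx')).1
    have h6 : η * τ ≤ η * (((k' : ℝ) - k) * τ) := by
      have : 0 < η * τ := by positivity
      nlinarith
    simp only at h4 h5
    linarith
  have hdisj : Set.PairwiseDisjoint (↑(Finset.range (n + 1))) B := by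
    intro k hk k' hk' hne
    simp only [Finset.coe_range, Set.mem_Iio] at hk hk'
    refine Set.disjoint_left.2 fun x hx hx' => ?_
    rcases lt_or_gt_of_ne hne with h | h
    · exact key k k' h (by omega) x hx hx'
    · exact key k' k h (by omega) x hx' hx
  have hsub : (⋃ k ∈ Finset.range (n + 1), B k) ⊆ closedBall 0 (R + s0) := by
    intro x hx
    simp only [Set.mem_iUnion, Finset.mem_range] at hx
    obtain ⟨k, hk, hx⟩ := hx
    have h1 := hAR hx
    rw [mem_closedBall_zero_iff] at h1 ⊢
    have h2 : x = (x + (-((k : ℝ) * τ)) • e) + ((k : ℝ) * τ) • e := by module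
    rw [h2]
    refine (norm_add_le _ _).trans (add_le_add h1 ?_)
    rw [norm_smul, Real.norm_of_nonneg (by positivity)]
    have hk' : (k : ℝ) ≤ n := by exact_mod_cast Nat.lt_succ_iff.1 hk
    calc (k : ℝ) * τ * ‖e‖ ≤ n * τ * 1 := by gcongr
      _ ≤ s0 := by linarith
  have hsum : ((n : ℝ) + 1) * volume.real A ≤ volume.real (closedBall (0 : Euc N) (R + s0)) := by
    have h1 := measure_mono (μ := volume) hsub
    rw [measure_biUnion_finset hdisj (fun k _ => hBm k)] at h1
    simp only [hBv, Finset.sum_const, Finset.card_range, nsmul_eq_mul] at h1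
    have h2 := ENNReal.toReal_mono measure_closedBall_lt_top.ne h1
    rw [ENNReal.toReal_mul, ENNReal.toReal_natCast] at h2
    push_cast at h2
    exact h2
  rw [div_mul_eq_mul_div, le_div_iff₀ hs0]
  have h0 : 0 ≤ volume.real A := measureReal_nonneg
  calc volume.real A * s0 ≤ volume.real A * (((n : ℝ) + 1) * τ) := by gcongr
    _ = τ * (((n : ℝ) + 1) * volume.real A) := by ring
    _ ≤ _ := by gcongr

/-- Linear growth in some direction from every point of `{|u| < δ₀}` bounds the volume of thin
bands around the zero level set linearly in their width. -/
lemma exists_band_bound (N : ℕ) {K η s0 δ0 : ℝ} (R : ℝ) (hK : 0 ≤ K) (hη : 0 < η) (hs0 : 0 < s0)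
    (hδ0 : 0 < δ0) :
    ∃ M : ℝ, 0 ≤ M ∧ ∀ u : Euc N → ℝ, LipBound K u →
      (∀ x, |u x| < δ0 → ∀ ε > 0, ∃ e : Euc N, ‖e‖ ≤ 1 ∧
        ∀ s ∈ Icc 0 s0, u x + η * s - ε ≤ u (x + s • e)) →
      ∀ δ > 0, volume.real ({x | |u x| ≤ δ} ∩ closedBall 0 R) ≤ M * δ := by
  obtain ⟨E, hE1, hEfin, hE⟩ := (isCompact_closedBall (0 : Euc N) 1).finite_cover_balls
    (e := η / (2 * (K + 1))) (by positivity)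
  set V := volume.real (closedBall (0 : Euc N) (R + s0)) with hV
  set V0 := volume.real (closedBall (0 : Euc N) R) with hV0
  have hV1 : 0 ≤ V := measureReal_nonneg
  have hV2 : 0 ≤ V0 := measureReal_nonneg
  refine ⟨hEfin.toFinset.card * (8 / η / s0 * V) + V0 / δ0, by positivity, ?_⟩
  intro u hu hdir δ hδ
  rcases le_or_gt δ0 δ with hle | hlt
  · have h1 : volume.real ({x | |u x| ≤ δ} ∩ closedBall 0 R) ≤ V0 :=
      measureReal_mono inter_subset_right measure_closedBall_lt_top.ne
    have h2 : V0 ≤ V0 / δ0 * δ := by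
      rw [div_mul_eq_mul_div, le_div_iff₀ hδ0]; gcongr
    have h3 : 0 ≤ hEfin.toFinset.card * (8 / η / s0 * V) := by positivity
    nlinarith
  · set A : Euc N → Set (Euc N) := fun e => {x | |u x| ≤ δ} ∩ closedBall 0 R ∩
      {x | ∀ s ∈ Icc 0 s0, u x + η / 2 * s - δ ≤ u (x + s • e)} with hA
    have hAclosed : ∀ e, IsClosed (A e) := by
      intro e
      refine ((isClosed_le hu.continuous.abs continuous_const).inter isClosed_closedBall).inter ?_
      have : {x | ∀ s ∈ Icc 0 s0, u x + η / 2 * s - δ ≤ u (x + s • e)} =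
          ⋂ s ∈ Icc 0 s0, {x | u x + η / 2 * s - δ ≤ u (x + s • e)} := by
        ext; simp
      rw [this]
      refine isClosed_biInter fun s _ => isClosed_le ?_ ?_
      · exact (hu.continuous.add continuous_const).sub continuous_const
      · exact hu.continuous.comp (continuous_id.add continuous_const)
    have hcov : {x | |u x| ≤ δ} ∩ closedBall 0 R ⊆ ⋃ e ∈ hEfin.toFinset, A e := by
      rintro x ⟨hx, hxR⟩
      obtain ⟨e, he, hes⟩ := hdir x (lt_of_le_of_lt hx hlt) δ hδ
      obtain ⟨e', he', hee⟩ := Set.mem_iUnion₂.1 (hE (mem_closedBall_zero_iff.2 he))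
      refine Set.mem_iUnion₂.2 ⟨e', hEfin.mem_toFinset.2 he', ⟨hx, hxR⟩, fun s hs => ?_⟩
      rw [mem_ball, dist_eq_norm, lt_div_iff₀ (by positivity)] at hee
      have h1 := hes s hs
      have h2 := hu (x + s • e) (x + s • e')
      rw [add_sub_add_left_eq_sub, ← smul_sub, norm_smul, Real.norm_of_nonneg hs.1] at h2
      have h3 : K * (s * ‖e - e'‖) ≤ η / 2 * s := by
        have : K * ‖e - e'‖ ≤ η / 2 := by nlinarith [norm_nonneg (e - e')]
        have := mul_le_mul_of_nonneg_left this hs.1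
        linarith
      linarith
    calc volume.real ({x | |u x| ≤ δ} ∩ closedBall 0 R)
        ≤ volume.real (⋃ e ∈ hEfin.toFinset, A e) := by
          refine measureReal_mono hcov (ne_top_of_le_ne_top measure_closedBall_lt_top.ne
            (measure_mono (t := closedBall 0 R) ?_))
          exact Set.iUnion₂_subset fun e _ x hx => hx.1.2
      _ ≤ ∑ e ∈ hEfin.toFinset, volume.real (A e) := measureReal_biUnion_finset_le _ _
      _ ≤ ∑ e ∈ hEfin.toFinset, 4 * δ / (η / 2) / s0 * V := by
          refine Finset.sum_le_sum fun e he => ?_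
          refine volume_le_of_increasing hδ (by positivity) hs0
            (mem_closedBall_zero_iff.1 (hE1 (hEfin.mem_toFinset.1 he)))
            (hAclosed e).measurableSet (fun x hx => hx.1.2) (fun x hx => hx.1.1)
            (fun x hx => hx.2)
      _ = hEfin.toFinset.card * (8 / η / s0 * V) * δ := by
          rw [Finset.sum_const, nsmul_eq_mul]; field_simp; ring
      _ ≤ _ := by
          have : 0 ≤ V0 / δ0 * δ := by positivity
          nlinarith

/-- Assumptions on the kernel `c0` and the driving force `c1` of the nonlocal speed. -/
structure SpeedData (T L B Λ : ℝ) (c0 c1 : Euc N → ℝ → ℝ) : Prop where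
  cont1 : ContinuousOn (fun p : Euc N × ℝ => c1 p.1 p.2) (univ ×ˢ Icc (0 : ℝ) T)
  L_pos : 0 < L
  B_pos : 0 < B
  Λ_pos : 0 < Λ
  lip0 : ∀ x y : Euc N, ∀ t ∈ Icc (0 : ℝ) T, |c0 x t - c0 y t| ≤ L * ‖x - y‖ ∧ |c0 x t| ≤ B
  lip1 : ∀ x y : Euc N, ∀ t ∈ Icc (0 : ℝ) T, |c1 x t - c1 y t| ≤ L * ‖x - y‖ ∧ |c1 x t| ≤ B
  semi0 : ∀ t ∈ Icc (0 : ℝ) T, Semiconvex Λ (fun x => c0 x t)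
  semi1 : ∀ t ∈ Icc (0 : ℝ) T, Semiconvex Λ (fun x => c1 x t)
  int0 : ∀ t ∈ Icc (0 : ℝ) T, Integrable (fun y => c0 y t)
  cont0 : ∀ t ∈ Icc (0 : ℝ) T,
    Tendsto (fun s => ∫ y : Euc N, |c0 y s - c0 y t|) (𝓝[Icc (0 : ℝ) T] t) (𝓝 0)
  dom : ∀ x : Euc N, ∀ t ∈ Icc (0 : ℝ) T, (∫ y : Euc N, |c0 y t|) ≤ c1 x t

/-- The nonlocal speed generated by the set `A`. -/
def speed (c0 c1 : Euc N → ℝ → ℝ) (A : Set (Euc N)) (x : Euc N) (t : ℝ) : ℝ :=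
  (∫ y in A, c0 (y - x) t) + c1 x t

lemma speed_eq (c0 c1 : Euc N → ℝ → ℝ) {A : Set (Euc N)} (hA : MeasurableSet A) {p : Euc N → Prop}
    [DecidablePred p] (hp : ∀ y, p y ↔ y ∈ A) (x : Euc N) (t : ℝ) :
    (∫ y : Euc N, c0 (y - x) t * (if p y then (1 : ℝ) else 0)) + c1 x t = speed c0 c1 A x t := by
  rw [speed, ← integral_indicator hA]
  congr 2
  ext y
  by_cases h : p y
  · rw [if_pos h, mul_one, indicator_of_mem ((hp y).1 h)]
  · rw [if_neg h, mul_zero, indicator_of_notMem (fun h' => h ((hp y).2 h'))]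

namespace SpeedData

variable {T L B Λ R : ℝ} {c0 c1 : Euc N → ℝ → ℝ} {A A' : Set (Euc N)} {t : ℝ}

lemma integrable_shift (h : SpeedData T L B Λ c0 c1) (ht : t ∈ Icc 0 T) (x : Euc N) :
    Integrable (fun y => c0 (y - x) t) := (h.int0 t ht).comp_sub_right x

lemma abs_integral_le (h : SpeedData T L B Λ c0 c1) (ht : t ∈ Icc 0 T) (A : Set (Euc N))
    (x : Euc N) : |∫ y in A, c0 (y - x) t| ≤ c1 x t := by
  calc |∫ y in A, c0 (y - x) t| ≤ ∫ y in A, |c0 (y - x) t| := abs_integral_le_integral_abs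
    _ ≤ ∫ y, |c0 (y - x) t| :=
        setIntegral_le_integral (h.integrable_shift ht x).abs (ae_of_all _ fun _ => abs_nonneg _)
    _ = ∫ y, |c0 y t| := integral_sub_right_eq_self (fun y => |c0 y t|) x
    _ ≤ c1 x t := h.dom x t ht

lemma speed_nonneg (h : SpeedData T L B Λ c0 c1) (ht : t ∈ Icc 0 T) (A : Set (Euc N))
    (x : Euc N) : 0 ≤ speed c0 c1 A x t := by
  have := (abs_le.1 (h.abs_integral_le ht A x)).1
  rw [speed]; linarith

lemma speed_le (h : SpeedData T L B Λ c0 c1) (ht : t ∈ Icc 0 T) (A : Set (Euc N))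
    (x : Euc N) : speed c0 c1 A x t ≤ 2 * B := by
  have := (abs_le.1 (h.abs_integral_le ht A x)).2
  have := (abs_le.1 (h.lip1 x x t ht).2).2
  rw [speed]; linarith

lemma volume_lt_top (hAR : A ⊆ closedBall 0 R) : volume A < ⊤ :=
  (measure_mono hAR).trans_lt measure_closedBall_lt_top

lemma volume_real_le (hAR : A ⊆ closedBall 0 R) :
    volume.real A ≤ volume.real (closedBall (0 : Euc N) R) :=
  measureReal_mono hAR measure_closedBall_lt_top.ne

lemma speed_lipBound (h : SpeedData T L B Λ c0 c1) (ht : t ∈ Icc 0 T)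
    (hAR : A ⊆ closedBall 0 R) :
    LipBound (L * (volume.real (closedBall (0 : Euc N) R) + 1)) (fun x => speed c0 c1 A x t) := by
  intro x x'
  simp only [speed]
  have h1 : |∫ y in A, (c0 (y - x) t - c0 (y - x') t)| ≤ (L * ‖x - x'‖) * volume.real A := by
    rw [← Real.norm_eq_abs]
    refine norm_setIntegral_le_of_norm_le_const (volume_lt_top hAR) fun y _ => ?_
    rw [Real.norm_eq_abs]
    have := (h.lip0 (y - x) (y - x') t ht).1
    rwa [sub_sub_sub_cancel_left, norm_sub_rev] at this
  rw [integral_sub (h.integrable_shift ht x).integrableOn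
    (h.integrable_shift ht x').integrableOn] at h1
  have h2 := (abs_le.1 (h.lip1 x x' t ht).1).2
  have h3 := (abs_le.1 h1).2
  have h4 : (L * ‖x - x'‖) * volume.real A ≤
      (L * ‖x - x'‖) * volume.real (closedBall (0 : Euc N) R) :=
    mul_le_mul_of_nonneg_left (volume_real_le hAR) (mul_nonneg h.L_pos.le (norm_nonneg _))
  linarith

lemma speed_semiconvex (h : SpeedData T L B Λ c0 c1) (ht : t ∈ Icc 0 T)
    (hA : MeasurableSet A) (hAR : A ⊆ closedBall 0 R) :
    Semiconvex (Λ * (volume.real (closedBall (0 : Euc N) R) + 1))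
      (fun x => speed c0 c1 A x t) := by
  intro x z
  have h1 := h.semi1 t ht x z
  simp only [speed] at h1 ⊢
  have hi := fun x => (h.integrable_shift ht x).integrableOn (s := A)
  have h2 : ∫ y in A, (-Λ * ‖z‖ ^ 2) ≤
      ∫ y in A, (c0 (y - (x + z)) t - 2 * c0 (y - x) t + c0 (y - (x - z)) t) := by
    refine setIntegral_mono_on (integrableOn_const (volume_lt_top hAR).ne)
      (((hi _).sub ((hi _).const_mul 2)).add (hi _)) hA fun y _ => ?_
    have := h.semi0 t ht (y - x) z
    simp only at this
    rw [show y - (x + z) = y - x - z by abel, show y - (x - z) = y - x + z by abel]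
    linarith
  have h3 : IntegrableOn (fun y => c0 (y - (x + z)) t - 2 * c0 (y - x) t) A :=
    (hi _).sub ((hi _).const_mul 2)
  rw [integral_add h3 (hi _), integral_sub (hi _) ((hi _).const_mul 2), setIntegral_const,
    integral_const_mul, smul_eq_mul] at h2
  have h4 : volume.real A * (Λ * ‖z‖ ^ 2) ≤
      volume.real (closedBall (0 : Euc N) R) * (Λ * ‖z‖ ^ 2) :=
    mul_le_mul_of_nonneg_right (volume_real_le hAR)
      (mul_nonneg h.Λ_pos.le (sq_nonneg _))
  linarith

lemma speed_sub_set (h : SpeedData T L B Λ c0 c1) (ht : t ∈ Icc 0 T)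
    (hA : MeasurableSet A) (hA' : MeasurableSet A') {S : Set (Euc N)} (hS : volume S ≠ ⊤)
    (h1 : A \ A' ⊆ S) (h2 : A' \ A ⊆ S) (x : Euc N) :
    |speed c0 c1 A x t - speed c0 c1 A' x t| ≤ 2 * B * volume.real S := by
  have hi := h.integrable_shift ht x
  have key : ∀ D ⊆ S, |∫ y in D, c0 (y - x) t| ≤ B * volume.real S := by
    intro D hD
    rw [← Real.norm_eq_abs]
    calc ‖∫ y in D, c0 (y - x) t‖ ≤ B * volume.real D :=
          norm_setIntegral_le_of_norm_le_const (lt_of_le_of_lt (measure_mono hD) hS.lt_top)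
            fun y _ => by rw [Real.norm_eq_abs]; exact (h.lip0 (y - x) 0 t ht).2
      _ ≤ _ := mul_le_mul_of_nonneg_left (measureReal_mono hD hS) h.B_pos.le
  have e1 := integral_inter_add_sdiff (μ := volume) (s := A) hA' hi.integrableOn
  have e2 := integral_inter_add_sdiff (μ := volume) (s := A') hA hi.integrableOn
  rw [inter_comm] at e2
  have k1 := abs_le.1 (key _ h1)
  have k2 := abs_le.1 (key _ h2)
  simp only [speed]
  rw [abs_le]
  constructor <;> linarith

lemma speed_sub_time (h : SpeedData T L B Λ c0 c1) {s : ℝ} (hs : s ∈ Icc 0 T) (ht : t ∈ Icc 0 T)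
    (A : Set (Euc N)) (x : Euc N) :
    |speed c0 c1 A x s - speed c0 c1 A x t| ≤
      (∫ y : Euc N, |c0 y s - c0 y t|) + |c1 x s - c1 x t| := by
  have h1 : |∫ y in A, (c0 (y - x) s - c0 (y - x) t)| ≤ ∫ y : Euc N, |c0 y s - c0 y t| := by
    calc _ ≤ ∫ y in A, |c0 (y - x) s - c0 (y - x) t| := abs_integral_le_integral_abs
      _ ≤ ∫ y, |c0 (y - x) s - c0 (y - x) t| :=
        setIntegral_le_integral ((h.integrable_shift hs x).sub (h.integrable_shift ht x)).abs
          (ae_of_all _ fun _ => abs_nonneg _)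
      _ = _ := integral_sub_right_eq_self (fun y => |c0 y s - c0 y t|) x
  rw [integral_sub (h.integrable_shift hs x).integrableOn
    (h.integrable_shift ht x).integrableOn] at h1
  simp only [speed]
  rw [show ∀ a b c d : ℝ, a + b - (c + d) = (a - c) + (b - d) by intros; ring]
  exact (abs_add_le _ _).trans (add_le_add_left h1 _)

end SpeedData

/-- The times `k τ`, frozen at `T`. -/
def stepTime (T τ : ℝ) (k : ℕ) : ℝ := min (k * τ) T

/-- Discrete evolution: the front moves for a time `τ` with the speed frozen. -/
def evolve (c0 c1 : Euc N → ℝ → ℝ) (R T τ : ℝ) (u0 : Euc N → ℝ) : ℕ → Euc N → ℝ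
  | 0 => u0
  | k + 1 => hopf (fun x => τ * speed c0 c1 ({y | 0 ≤ evolve c0 c1 R T τ u0 k y} ∩ closedBall 0 R) x
      (stepTime T τ k)) (evolve c0 c1 R T τ u0 k)

/-- A function which evolves approximately, up to the time resolution `τ`, with the nonlocal
speed generated by its own superlevel sets. -/
structure IsApprox (T K C m R η s0 δ0 : ℝ) (c0 c1 : Euc N → ℝ → ℝ) (u0 : Euc N → ℝ) (τ : ℝ)
    (v : Euc N → ℝ → ℝ) : Prop where
  lip : ∀ t ∈ Icc 0 T, LipBound K (fun x => v x t)
  initial : ∀ x, v x 0 = u0 x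
  mono : ∀ x, ∀ s ∈ Icc 0 T, ∀ t ∈ Icc 0 T, s ≤ t → v x s ≤ v x t
  time : ∀ x, ∀ s ∈ Icc 0 T, ∀ t ∈ Icc 0 T, s ≤ t → v x t ≤ v x s + K * (C * (t - s + τ))
  far : ∀ t ∈ Icc 0 T, ∀ x, R < ‖x‖ → v x t ≤ -m
  dir : ∀ t ∈ Icc 0 T, ∀ x, |v x t| < δ0 → ∀ ε > 0, ∃ e : Euc N, ‖e‖ ≤ 1 ∧
    ∀ s ∈ Icc 0 s0, v x t + η * s - ε ≤ v (x + s • e) t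
  back : ∀ x0, ∀ s ∈ Icc 0 T, ∀ t ∈ Icc 0 T, s ≤ t → ∀ γ ≥ 0,
    (∀ s' ∈ Icc 0 T, s - τ ≤ s' → s' ≤ t → ∀ x, ‖x - x0‖ ≤ (t - s + τ) * γ →
      speed c0 c1 ({y | 0 ≤ v y s'} ∩ closedBall 0 R) x s' ≤ γ) →
    ∃ y, ‖y - x0‖ ≤ (t - s + τ) * γ ∧ v x0 t = v y s
  forward : ∀ x0, ∀ s ∈ Icc 0 T, ∀ t ∈ Icc 0 T, s ≤ t → ∀ γ ≥ 0,
    (∀ s' ∈ Icc 0 T, s - τ ≤ s' → s' ≤ t → ∀ x, ‖x - x0‖ ≤ (t - s + τ) * γ →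
      γ ≤ speed c0 c1 ({y | 0 ≤ v y s'} ∩ closedBall 0 R) x s') →
    ∀ y, ‖y - x0‖ ≤ (t - s - τ) * γ → v y s ≤ v x0 t

lemma stepTime_mem {T τ : ℝ} (hT : 0 ≤ T) (hτ : 0 ≤ τ) (k : ℕ) : stepTime T τ k ∈ Icc 0 T :=
  ⟨le_min (by positivity) hT, min_le_right _ _⟩

lemma semiconvex_mono {C C' : ℝ} {w : Euc N → ℝ} (h : Semiconvex C w) (hC : C ≤ C') :
    Semiconvex C' w := fun x z => by
  have := h x z
  have := mul_le_mul_of_nonneg_right hC (sq_nonneg ‖z‖)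
  linarith

lemma evolve_continuous {T L B Λ R τ K : ℝ} {c0 c1 : Euc N → ℝ → ℝ} {u0 : Euc N → ℝ}
    (hd : SpeedData T L B Λ c0 c1) (hT : 0 ≤ T) (hτ : 0 ≤ τ) (hK : 0 ≤ K) (h0 : LipBound K u0) :
    (∀ k, Continuous (evolve c0 c1 R T τ u0 k)) ∧
    IsScheme (evolve c0 c1 R T τ u0)
      (fun k x => τ * speed c0 c1 ({y | 0 ≤ evolve c0 c1 R T τ u0 k y} ∩ closedBall 0 R) x
        (stepTime T τ k)) (τ * (2 * B))
      (τ * (L * (volume.real (closedBall (0 : Euc N) R) + 1)))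
      (τ * (Λ * (volume.real (closedBall (0 : Euc N) R) + 1))) := by
  set V := volume.real (closedBall (0 : Euc N) R) + 1 with hV
  have hVp : 0 ≤ V := by positivity
  have hl : 0 ≤ τ * (L * V) := mul_nonneg hτ (mul_nonneg hd.L_pos.le hVp)
  have hm := stepTime_mem hT hτ
  have hn : ∀ k x, 0 ≤ τ * speed c0 c1 ({y | 0 ≤ evolve c0 c1 R T τ u0 k y} ∩ closedBall 0 R) x
      (stepTime T τ k) := fun k x => mul_nonneg hτ (hd.speed_nonneg (hm k) _ _)
  have hlip : ∀ k, LipBound (τ * (L * V)) (fun x => τ * speed c0 c1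
      ({y | 0 ≤ evolve c0 c1 R T τ u0 k y} ∩ closedBall 0 R) x (stepTime T τ k)) := by
    intro k x y
    have := mul_le_mul_of_nonneg_left
      (hd.speed_lipBound (hm k) (inter_subset_right (s := {y | 0 ≤ evolve c0 c1 R T τ u0 k y})
        (t := closedBall 0 R)) x y) hτ
    simp only at this ⊢
    linarith
  have hcont : ∀ k, LipBound (K * (1 + τ * (L * V)) ^ k) (evolve c0 c1 R T τ u0 k) := by
    intro k
    induction k with
    | zero => simpa [evolve] using h0
    | succ k ih =>
      rw [pow_succ, ← mul_assoc]
      exact hopf_lipBound (by positivity) ih (hn k) (hlip k)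
  refine ⟨fun k => (hcont k).continuous, fun k => rfl, hn, fun k x =>
    mul_le_mul_of_nonneg_left (hd.speed_le (hm k) _ _) hτ, hlip, fun k x z => ?_⟩
  have hms : MeasurableSet ({y | 0 ≤ evolve c0 c1 R T τ u0 k y} ∩ closedBall 0 R) :=
    (isClosed_le continuous_const (hcont k).continuous).measurableSet.inter measurableSet_closedBall
  have := mul_le_mul_of_nonneg_left
    (hd.speed_semiconvex (hm k) hms inter_subset_right x z) hτ
  simp only at this ⊢
  linarith

lemma exp_le_one_sub_pow {l : ℝ} (hl : 0 ≤ l) (hl2 : l ≤ 1 / 2) (n : ℕ) :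
    Real.exp (-2 * (n * l)) ≤ (1 - l) ^ n := by
  have h1 : Real.exp (-2 * l) ≤ 1 - l := by
    have h := Real.add_one_le_exp (2 * l)
    have h3 : (1 : ℝ) ≤ (1 - l) * Real.exp (2 * l) := by nlinarith
    rw [show -2 * l = -(2 * l) by ring, Real.exp_neg, inv_le_iff_one_le_mul₀ (Real.exp_pos _)]
    exact h3
  calc Real.exp (-2 * (n * l)) = Real.exp (-2 * l) ^ n := by
        rw [← Real.exp_nat_mul]; ring_nf
    _ ≤ _ := pow_le_pow_left₀ (Real.exp_pos _).le h1 n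

lemma one_add_pow_le_exp {l : ℝ} (hl : 0 ≤ l) (n : ℕ) : (1 + l) ^ n ≤ Real.exp (n * l) := by
  rw [Real.exp_nat_mul]
  exact pow_le_pow_left₀ (by linarith) (by linarith [Real.add_one_le_exp l]) n

set_option maxHeartbeats 1000000 in
lemma exists_approx {T L B Λ R K C m η δ0 : ℝ} {c0 c1 : Euc N → ℝ → ℝ} {u0 : Euc N → ℝ}
    (hd : SpeedData T L B Λ c0 c1) (hT : 0 < T) (hK : 0 ≤ K) (hC : 0 ≤ C) (hη : 0 < η)
    (h0 : LipBound K u0) (hsc : Semiconvex C u0) (hsl : SlopeGE η δ0 u0)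
    (hfar : ∀ x y : Euc N, R < ‖x‖ → ‖y - x‖ ≤ 2 * B * T → u0 y ≤ -m) :
    ∃ K' ≥ K, ∃ η' > 0, ∃ s0 > 0, ∀ᶠ n : ℕ in atTop, ∃ v,
      IsApprox T K' (2 * B) m R η' s0 δ0 c0 c1 u0 (T / n) v := by
  set V := volume.real (closedBall (0 : Euc N) R) + 1 with hV
  have hVp : 0 < V := by positivity
  have hLp := hd.L_pos
  have hBp := hd.B_pos
  have hΛp := hd.Λ_pos
  set E := Real.exp (T * (L * V)) with hE
  have hE1 : 1 ≤ E := Real.one_le_exp (by positivity)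
  set C1 := E ^ 2 * (C + K * E * (T * (Λ * V))) with hC1
  have hC1p : 0 ≤ C1 := by positivity
  set η1 := η * Real.exp (-2 * (T * (L * V))) with hη1
  have hη1p : 0 < η1 := by positivity
  refine ⟨K * E, le_mul_of_one_le_right hK hE1, η1 / 2, by positivity, min 1 (η1 / (C1 + 1)),
    by positivity, ?_⟩
  have hlim : ∀ᶠ n : ℕ in atTop, T / n * (L * V) ≤ 1 / 2 := by
    have := (tendsto_const_div_atTop_nhds_zero_nat T).mul_const (L * V)
    rw [zero_mul] at this
    exact (this.eventually (gt_mem_nhds (by norm_num : (0 : ℝ) < 1 / 2))).mono fun n h => h.le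
  filter_upwards [hlim, eventually_gt_atTop 0] with n hn hn0
  have hn0' : (0 : ℝ) < n := by exact_mod_cast hn0
  set τ := T / n with hτ
  have hτp : 0 < τ := by positivity
  have hnτ : n * τ = T := by rw [hτ]; field_simp
  set U := evolve c0 c1 R T τ u0 with hU
  obtain ⟨hc, hS⟩ := evolve_continuous (R := R) hd hT.le hτp.le hK h0
  rw [← hV, ← hU] at hS
  rw [← hU] at hc
  set l := τ * (L * V) with hl
  have hlp : 0 ≤ l := by positivity
  have hnl : n * l = T * (L * V) := by rw [hl, ← mul_assoc, hnτ]
  have hpow : (1 + l) ^ n ≤ E := by rw [hE, ← hnl]; exact one_add_pow_le_exp hlp n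
  have hlip : ∀ k ≤ n, LipBound (K * E) (U k) := fun k hk =>
    (hS.lipBound_of_le hlp hK h0 hk).mono (mul_le_mul_of_nonneg_left hpow hK)
  have hKE : 0 ≤ K * E := by positivity
  have hfl : ∀ t ∈ Icc 0 T, ⌊t / τ⌋₊ ≤ n ∧ ⌊t / τ⌋₊ * τ ≤ t ∧ t < ⌊t / τ⌋₊ * τ + τ := by
    intro t ht
    refine ⟨?_, ?_, ?_⟩
    · apply Nat.floor_le_of_le
      rw [div_le_iff₀ hτp, hnτ]; exact ht.2
    · rw [← le_div_iff₀ hτp]; exact Nat.floor_le (div_nonneg ht.1 hτp.le)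
    · have := Nat.lt_floor_add_one (t / τ)
      rw [div_lt_iff₀ hτp] at this; linarith
  have hst : ∀ s ∈ Icc 0 T, ∀ t ∈ Icc 0 T, s ≤ t → ∃ p : ℕ, ⌊t / τ⌋₊ = ⌊s / τ⌋₊ + p ∧
      p * τ ≤ t - s + τ ∧ t - s - τ ≤ p * τ := by
    intro s hs t ht hst
    have h1 : ⌊s / τ⌋₊ ≤ ⌊t / τ⌋₊ := Nat.floor_mono (by gcongr)
    obtain ⟨p, hp⟩ := Nat.exists_eq_add_of_le h1
    have hs' := hfl s hs
    have ht' := hfl t ht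
    refine ⟨p, hp, ?_, ?_⟩ <;>
    · rw [hp] at ht'; push_cast at ht'; linarith [ht'.2.1, ht'.2.2, hs'.2.1, hs'.2.2]
  have hgrid : ∀ j ≤ n, ⌊(j * τ) / τ⌋₊ = j ∧ stepTime T τ j = j * τ ∧ j * τ ∈ Icc 0 T := by
    intro j hj
    have : j * τ ≤ T := by rw [← hnτ]; gcongr
    exact ⟨by rw [mul_div_cancel_right₀ _ hτp.ne', Nat.floor_natCast], min_eq_left this,
      by positivity, this⟩
  refine ⟨fun x t => U ⌊t / τ⌋₊ x, ⟨?_, ?_, ?_, ?_, ?_, ?_, ?_, ?_⟩⟩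
  · exact fun t ht => hlip _ (hfl t ht).1
  · intro x; simp [hU, evolve]
  · intro x s hs t ht h
    obtain ⟨p, hp, -, -⟩ := hst s hs t ht h
    have := (hS.time_bound hKE hlip hc x ⌊s / τ⌋₊ p (hp ▸ (hfl t ht).1)).1
    simp only [hp]; exact this
  · intro x s hs t ht h
    obtain ⟨p, hp, hp1, -⟩ := hst s hs t ht h
    have := (hS.time_bound hKE hlip hc x ⌊s / τ⌋₊ p (hp ▸ (hfl t ht).1)).2
    simp only [hp]
    refine this.trans (add_le_add le_rfl (mul_le_mul_of_nonneg_left ?_ hKE))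
    have := mul_le_mul_of_nonneg_left hp1 (by positivity : 0 ≤ 2 * B)
    linarith
  · intro t ht x hx
    obtain ⟨y, hy, he⟩ := hS.exists_reach hc ⌊t / τ⌋₊ x
    have he' : U ⌊t / τ⌋₊ x = u0 y := he
    simp only [he']
    refine hfar x y hx (hy.trans ?_)
    have h1 := mul_le_mul_of_nonneg_left ((hfl t ht).2.1.trans ht.2) (by positivity : 0 ≤ 2 * B)
    linarith
  · intro t ht x hx ε hε
    obtain ⟨hk, -, -⟩ := hfl t ht
    set k := ⌊t / τ⌋₊ with hkdef
    have hkT : k * τ ≤ T := by rw [← hnτ]; gcongr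
    have hsl' := hS.slopeGE hlp (by linarith) hK hη h0 hsl k x hx
    have hη1k : η1 ≤ η * (1 - l) ^ k := by
      refine mul_le_mul_of_nonneg_left ?_ hη.le
      rw [← hnl]
      exact (exp_le_one_sub_pow hlp hn n).trans (pow_le_pow_of_le_one (by linarith) (by linarith) hk)
    have hCk : Semiconvex C1 (U k) := by
      refine semiconvex_mono (hS.semiconvex hlp (by positivity) hK hC h0 hsc k hk) ?_
      have e1 : (1 + l) ^ (2 * k) ≤ E ^ 2 := by
        rw [mul_comm, pow_mul]
        exact pow_le_pow_left₀ (by positivity)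
          ((pow_le_pow_right₀ (by linarith) hk).trans hpow) 2
      have e2 : K * (1 + l) ^ n * (τ * (Λ * V)) * k ≤ K * E * (T * (Λ * V)) := by
        calc K * (1 + l) ^ n * (τ * (Λ * V)) * k = K * (1 + l) ^ n * ((k * τ) * (Λ * V)) := by ring
          _ ≤ _ := by gcongr
      exact mul_le_mul e1 (by linarith) (by positivity) (by positivity)
    obtain ⟨e, he, hs⟩ := exists_direction hC1p hKE hη1p hCk (hlip k hk)
      (fun ρ hρ => (hsl' ρ hρ).imp fun y hy => ⟨hy.1, hy.2.1,
        le_trans (add_le_add le_rfl (mul_le_mul_of_nonneg_right hη1k (norm_nonneg _))) hy.2.2⟩) hε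
    refine ⟨e, he, fun s hs' => ?_⟩
    have h1 := hs s ⟨hs'.1, hs'.2.trans (min_le_left _ _)⟩
    have h2 : C1 * s ≤ η1 := by
      have := hs'.2.trans (min_le_right _ _)
      rw [le_div_iff₀ (by positivity)] at this
      nlinarith [hs'.1]
    have h3 := mul_le_mul_of_nonneg_right h2 hs'.1
    linarith
  · intro x0 s hs t ht h γ hγ hsp
    obtain ⟨p, hp, hp1, -⟩ := hst s hs t ht h
    obtain ⟨y, hy, he⟩ := hS.exists_back hc (γ := τ * γ) (by positivity) ⌊s / τ⌋₊ p x0 (by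
      intro j hj hj' x hx
      have hjn : j ≤ n := by have := (hfl t ht).1; omega
      obtain ⟨g1, g2, g3⟩ := hgrid j hjn
      refine mul_le_mul_of_nonneg_left ?_ hτp.le
      rw [g2]
      have hj1 : (⌊s / τ⌋₊ : ℝ) ≤ j := by exact_mod_cast hj
      have hj2 : (j : ℝ) ≤ ⌊t / τ⌋₊ := by rw [hp]; exact_mod_cast hj'.le
      have hj1' := mul_le_mul_of_nonneg_right hj1 hτp.le
      have hj2' := mul_le_mul_of_nonneg_right hj2 hτp.le
      have := hsp (j * τ) g3 (by linarith [(hfl s hs).2.2]) (by linarith [(hfl t ht).2.1]) x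
        (hx.trans (by rw [← mul_assoc]; gcongr))
      simpa only [g1] using this)
    refine ⟨y, hy.trans (by rw [← mul_assoc]; gcongr), by simp only [hp]; exact he⟩
  · intro x0 s hs t ht h γ hγ hsp y hy
    obtain ⟨p, hp, hp1, hp2⟩ := hst s hs t ht h
    have := hS.le_forward hc (γ := τ * γ) (by positivity) ⌊s / τ⌋₊ p x0 (by
      intro j hj hj' x hx
      have hjn : j ≤ n := by have := (hfl t ht).1; omega
      obtain ⟨g1, g2, g3⟩ := hgrid j hjn
      refine mul_le_mul_of_nonneg_left ?_ hτp.le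
      rw [g2]
      have hj1 : (⌊s / τ⌋₊ : ℝ) ≤ j := by exact_mod_cast hj
      have hj2 : (j : ℝ) ≤ ⌊t / τ⌋₊ := by rw [hp]; exact_mod_cast hj'.le
      have hj1' := mul_le_mul_of_nonneg_right hj1 hτp.le
      have hj2' := mul_le_mul_of_nonneg_right hj2 hτp.le
      have := hsp (j * τ) g3 (by linarith [(hfl s hs).2.2]) (by linarith [(hfl t ht).2.1]) x
        (hx.trans (by rw [← mul_assoc]; gcongr))
      simpa only [g1] using this) y (hy.trans (by rw [← mul_assoc]; gcongr))
    simp only [hp]; exact this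

lemma eventually_forall_abs_sub_le {l : Filter ℕ} {K ε : ℝ} {w : ℕ → Euc N → ℝ} {w0 : Euc N → ℝ}
    (hK : 0 ≤ K) (hw : ∀ᶠ n in l, LipBound K (w n)) (h0 : LipBound K w0)
    (hlim : ∀ x, Tendsto (fun n => w n x) l (𝓝 (w0 x))) {S : Set (Euc N)} (hS : IsCompact S)
    (hε : 0 < ε) : ∀ᶠ n in l, ∀ x ∈ S, |w n x - w0 x| ≤ ε := by
  obtain ⟨E, -, hEf, hE⟩ := hS.finite_cover_balls (e := ε / (4 * (K + 1))) (by positivity)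
  have h1 : ∀ᶠ n in l, ∀ y ∈ E, |w n y - w0 y| < ε / 2 := by
    rw [hEf.eventually_all]
    intro y _
    have := (hlim y).eventually (Metric.ball_mem_nhds _ (half_pos hε))
    filter_upwards [this] with n hn
    rwa [← Real.dist_eq]
  filter_upwards [hw, h1] with n hn hn1 x hx
  obtain ⟨y, hy, hxy⟩ := mem_iUnion₂.1 (hE hx)
  rw [mem_ball, dist_eq_norm, lt_div_iff₀ (by positivity)] at hxy
  have a1 := abs_le.1 (hn.abs_le x y)
  have a2 := abs_le.1 (h0.abs_le x y)
  have a3 := abs_lt.1 (hn1 y hy)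
  have a4 : K * ‖x - y‖ ≤ ε / 4 := by nlinarith [norm_nonneg (x - y)]
  rw [abs_le]
  constructor <;> linarith

/-- `u` is the limit, along the filter `l`, of approximate evolutions with vanishing resolution. -/
structure IsLimit (T K C m R η s0 δ0 : ℝ) (c0 c1 : Euc N → ℝ → ℝ) (u0 : Euc N → ℝ)
    (l : Filter ℕ) (τ : ℕ → ℝ) (v : ℕ → Euc N → ℝ → ℝ) (u : Euc N → ℝ → ℝ) : Prop where
  pos : ∀ᶠ n in l, 0 < τ n
  zero : Tendsto τ l (𝓝 0)
  approx : ∀ᶠ n in l, IsApprox T K C m R η s0 δ0 c0 c1 u0 (τ n) (v n)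
  lim : ∀ x, ∀ t ∈ Icc 0 T, Tendsto (fun n => v n x t) l (𝓝 (u x t))

lemma exists_isLimit {T K C m R η s0 δ0 : ℝ} {c0 c1 : Euc N → ℝ → ℝ} {u0 : Euc N → ℝ}
    (hT : 0 < T)
    (h : ∀ᶠ n : ℕ in atTop, ∃ v, IsApprox T K C m R η s0 δ0 c0 c1 u0 (T / n) v) :
    ∃ v u, IsLimit T K C m R η s0 δ0 c0 c1 u0 (hyperfilter ℕ) (fun n => T / n) v u := by
  have hle : (hyperfilter ℕ : Filter ℕ) ≤ atTop := Nat.hyperfilter_le_atTop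
  obtain ⟨v, hv⟩ := h.choice
  have hz := (tendsto_const_div_atTop_nhds_zero_nat T).mono_left hle
  have hv' := hle hv
  have key : ∀ x, ∀ t, ∃ a, t ∈ Icc 0 T → Tendsto (fun n => v n x t) (hyperfilter ℕ) (𝓝 a) := by
    intro x t
    by_cases ht : t ∈ Icc 0 T
    swap
    · exact ⟨0, fun h => absurd h ht⟩
    have hb : ∃ b, ∀ᶠ n in (hyperfilter ℕ : Filter ℕ), v n x t ∈ Icc (u0 x) b := by
      refine ⟨u0 x + |K * C| * (t + 1), ?_⟩
      filter_upwards [hv', hz.eventually (gt_mem_nhds one_pos), hle (eventually_gt_atTop 0)]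
        with n hn hn1 hn2
      have h0 : (0 : ℝ) ∈ Icc 0 T := ⟨le_rfl, hT.le⟩
      have hp : 0 < T / n := by positivity
      have a1 := hn.mono x 0 h0 t ht ht.1
      have a2 := hn.time x 0 h0 t ht ht.1
      rw [hn.initial] at a1 a2
      refine ⟨a1, a2.trans (add_le_add le_rfl ?_)⟩
      rw [← mul_assoc]
      have := ht.1
      refine (mul_le_mul_of_nonneg_right (le_abs_self _) (by linarith)).trans
        (mul_le_mul_of_nonneg_left (by linarith) (abs_nonneg _))
    obtain ⟨b, hb⟩ := hb
    obtain ⟨a, -, ha⟩ := isCompact_Icc.ultrafilter_le_nhds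
      (Ultrafilter.map (fun n => v n x t) (hyperfilter ℕ)) (le_principal_iff.2 hb)
    exact ⟨a, fun _ => ha⟩
  choose u hu using key
  refine ⟨v, u, ?_, hz, hv', hu⟩
  filter_upwards [hle (eventually_gt_atTop 0)] with n hn
  positivity

namespace IsLimit

variable {T K C m R η s0 δ0 : ℝ} {c0 c1 : Euc N → ℝ → ℝ} {u0 : Euc N → ℝ}
    {l : Filter ℕ} {τ : ℕ → ℝ} {v : ℕ → Euc N → ℝ → ℝ} {u : Euc N → ℝ → ℝ} {s t : ℝ}

lemma lip [l.NeBot] (h : IsLimit T K C m R η s0 δ0 c0 c1 u0 l τ v u) (ht : t ∈ Icc 0 T) :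
    LipBound K (fun x => u x t) := fun x y =>
  le_of_tendsto ((h.lim x t ht).sub (h.lim y t ht)) (h.approx.mono fun _ hn => hn.lip t ht x y)

lemma initial [l.NeBot] (h : IsLimit T K C m R η s0 δ0 c0 c1 u0 l τ v u) (hT : 0 ≤ T) (x : Euc N) :
    u x 0 = u0 x :=
  tendsto_nhds_unique (h.lim x 0 ⟨le_rfl, hT⟩)
    (tendsto_const_nhds.congr' (h.approx.mono fun _ hn => (hn.initial x).symm))

lemma mono [l.NeBot] (h : IsLimit T K C m R η s0 δ0 c0 c1 u0 l τ v u) (hs : s ∈ Icc 0 T)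
    (ht : t ∈ Icc 0 T) (hst : s ≤ t) (x : Euc N) : u x s ≤ u x t :=
  le_of_tendsto_of_tendsto (h.lim x s hs) (h.lim x t ht)
    (h.approx.mono fun _ hn => hn.mono x s hs t ht hst)

lemma time [l.NeBot] (h : IsLimit T K C m R η s0 δ0 c0 c1 u0 l τ v u) (hs : s ∈ Icc 0 T)
    (ht : t ∈ Icc 0 T) (hst : s ≤ t) (x : Euc N) : u x t ≤ u x s + K * (C * (t - s)) := by
  have := (h.lim x s hs).add (((h.zero.const_add (t - s)).const_mul C).const_mul K)
  rw [add_zero] at this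
  exact le_of_tendsto_of_tendsto (h.lim x t ht) this
    (h.approx.mono fun _ hn => hn.time x s hs t ht hst)

lemma abs_time_le [l.NeBot] (h : IsLimit T K C m R η s0 δ0 c0 c1 u0 l τ v u) (hs : s ∈ Icc 0 T)
    (ht : t ∈ Icc 0 T) (x : Euc N) : |u x s - u x t| ≤ K * (C * |s - t|) := by
  rcases le_total s t with hst | hst
  · have h1 := h.mono hs ht hst x
    have h2 := h.time hs ht hst x
    rw [abs_of_nonpos (by linarith), abs_of_nonpos (by linarith), neg_sub, neg_sub]
    linarith
  · have h1 := h.mono ht hs hst x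
    have h2 := h.time ht hs hst x
    rw [abs_of_nonneg (by linarith), abs_of_nonneg (by linarith)]
    linarith

lemma far [l.NeBot] (h : IsLimit T K C m R η s0 δ0 c0 c1 u0 l τ v u) (ht : t ∈ Icc 0 T)
    {x : Euc N} (hx : R < ‖x‖) : u x t ≤ -m :=
  le_of_tendsto (h.lim x t ht) (h.approx.mono fun _ hn => hn.far t ht x hx)

lemma close [l.NeBot] (h : IsLimit T K C m R η s0 δ0 c0 c1 u0 l τ v u) (hK : 0 ≤ K)
    (ht : t ∈ Icc 0 T) {S : Set (Euc N)} (hS : IsCompact S) {ε : ℝ} (hε : 0 < ε) :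
    ∀ᶠ n in l, ∀ x ∈ S, |v n x t - u x t| ≤ ε :=
  eventually_forall_abs_sub_le (w := fun n x => v n x t) hK
    (h.approx.mono fun _ hn => hn.lip t ht) (h.lip ht) (fun x => h.lim x t ht) hS hε

lemma dir [l.NeBot] (h : IsLimit T K C m R η s0 δ0 c0 c1 u0 l τ v u) (hK : 0 ≤ K)
    (ht : t ∈ Icc 0 T) {x : Euc N} (hx : |u x t| < δ0) {ε : ℝ} (hε : 0 < ε) :
    ∃ e : Euc N, ‖e‖ ≤ 1 ∧ ∀ s ∈ Icc 0 s0, u x t + η * s - ε ≤ u (x + s • e) t := by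
  have h1 : ∀ᶠ n in l, |v n x t| < δ0 := (h.lim x t ht).abs.eventually (gt_mem_nhds hx)
  obtain ⟨n, hn1, hn, hcl⟩ := (h1.and (h.approx.and
    (h.close hK ht (isCompact_closedBall x |s0|) (by positivity : 0 < ε / 3)))).exists
  obtain ⟨e, he, hs⟩ := hn.dir t ht x hn1 (ε / 3) (by positivity)
  refine ⟨e, he, fun s hs' => ?_⟩
  have a1 := abs_le.1 (hcl x (mem_closedBall_self (abs_nonneg _)))
  have a2 := abs_le.1 (hcl (x + s • e) (by
    rw [mem_closedBall, dist_eq_norm, add_sub_cancel_left, norm_smul, Real.norm_of_nonneg hs'.1]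
    exact (mul_le_of_le_one_right hs'.1 he).trans (hs'.2.trans (le_abs_self _))))
  have a3 := hs s hs'
  linarith

end IsLimit

lemma measurableSet_superlevel {K : ℝ} {w : Euc N → ℝ} (h : LipBound K w) :
    MeasurableSet {y | 0 ≤ w y} :=
  (isClosed_le continuous_const h.continuous).measurableSet

/-- Two superlevel sets of functions which are `δ`-close on a ball differ there only in a thin
band, which controls the difference of the speeds. -/
lemma abs_speed_sub_le {T L B Λ R δ : ℝ} {c0 c1 : Euc N → ℝ → ℝ}
    (hd : SpeedData T L B Λ c0 c1) {w w' : Euc N → ℝ} {A A' : Set (Euc N)}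
    (hA : A = {y | 0 ≤ w y} ∩ closedBall 0 R) (hA' : A' = {y | 0 ≤ w' y} ∩ closedBall 0 R)
    (hm : MeasurableSet A) (hm' : MeasurableSet A')
    (hδ : ∀ y ∈ closedBall 0 R, |w y - w' y| ≤ δ) {t : ℝ} (ht : t ∈ Icc 0 T) (x : Euc N) :
    |speed c0 c1 A x t - speed c0 c1 A' x t| ≤
      2 * B * volume.real ({y | |w' y| ≤ δ} ∩ closedBall 0 R) := by
  refine hd.speed_sub_set ht hm hm' ((measure_mono inter_subset_right).trans_lt
    measure_closedBall_lt_top).ne ?_ ?_ x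
  · rintro y ⟨hy, hy'⟩
    rw [hA] at hy
    have h1 : w' y < 0 := not_le.1 fun h => hy' (by rw [hA']; exact ⟨h, hy.2⟩)
    have h2 := abs_le.1 (hδ y hy.2)
    have h3 : 0 ≤ w y := hy.1
    exact ⟨show |w' y| ≤ δ from abs_le.2 ⟨by linarith, by linarith⟩, hy.2⟩
  · rintro y ⟨hy, hy'⟩
    rw [hA'] at hy
    have h1 : w y < 0 := not_le.1 fun h => hy' (by rw [hA]; exact ⟨h, hy.2⟩)
    have h2 := abs_le.1 (hδ y hy.2)
    have h3 : 0 ≤ w' y := hy.1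
    exact ⟨show |w' y| ≤ δ from abs_le.2 ⟨by linarith, by linarith⟩, hy.2⟩

/-- The speeds of a family of nearby functions are close to each other near a given point. -/
lemma exists_speed_close {T L B Λ R M : ℝ} {c0 c1 : Euc N → ℝ → ℝ}
    (hd : SpeedData T L B Λ c0 c1) {w : Euc N → ℝ} (hw : MeasurableSet {y | 0 ≤ w y})
    (hM : 0 ≤ M) (hband : ∀ δ > 0, volume.real ({x | |w x| ≤ δ} ∩ closedBall 0 R) ≤ M * δ)
    (x0 : Euc N) {t0 : ℝ} (ht0 : t0 ∈ Icc 0 T) {ε : ℝ} (hε : 0 < ε) :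
    ∃ r > 0, ∀ s ∈ Icc 0 T, |s - t0| ≤ r → ∀ x, ‖x - x0‖ ≤ r → ∀ w' : Euc N → ℝ,
      MeasurableSet {y | 0 ≤ w' y} → (∀ y ∈ closedBall 0 R, |w' y - w y| ≤ r) →
      |speed c0 c1 ({y | 0 ≤ w' y} ∩ closedBall 0 R) x s -
        speed c0 c1 ({y | 0 ≤ w y} ∩ closedBall 0 R) x0 t0| ≤ ε := by
  set V := L * (volume.real (closedBall (0 : Euc N) R) + 1) with hV
  have hLp := hd.L_pos
  have hBp := hd.B_pos
  have hVp : 0 < V := by positivity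
  have hc : Tendsto (fun s => c1 x0 s) (𝓝[Icc 0 T] t0) (𝓝 (c1 x0 t0)) := by
    have h1 := hd.cont1 (x0, t0) ⟨mem_univ _, ht0⟩
    have h2 : Tendsto (fun s : ℝ => (x0, s)) (𝓝[Icc 0 T] t0) (𝓝[univ ×ˢ Icc 0 T] (x0, t0)) := by
      refine tendsto_nhdsWithin_of_tendsto_nhds_of_eventually_within _
        (Tendsto.mono_left (by fun_prop : Continuous fun s : ℝ => (x0, s)).continuousAt
          nhdsWithin_le_nhds) ?_
      filter_upwards [self_mem_nhdsWithin] with s hs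
      exact ⟨mem_univ _, hs⟩
    exact h1.tendsto.comp h2
  have hc' := (hd.cont0 t0 ht0).add ((hc.sub_const (c1 x0 t0)).abs)
  rw [sub_self, abs_zero, add_zero] at hc'
  have hev := hc'.eventually (gt_mem_nhds (by positivity : 0 < ε / 3))
  obtain ⟨r1, hr1, hr⟩ := Metric.eventually_nhds_iff.1 (eventually_nhdsWithin_iff.1 hev)
  refine ⟨min (r1 / 2) (min (ε / (3 * V)) (ε / (3 * (2 * B * (M + 1))))), by positivity, ?_⟩
  intro s hs hst x hx w' hw' hcl
  have b1 : |s - t0| < r1 := by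
    have := hst.trans (min_le_left _ _); linarith
  have b2 := hx.trans ((min_le_right _ _).trans (min_le_left _ _))
  have b3 := fun y hy => (hcl y hy).trans ((min_le_right _ _).trans (min_le_right _ _))
  have hme := hw'.inter (measurableSet_closedBall (x := (0 : Euc N)) (ε := R))
  set A := {y | 0 ≤ w' y} ∩ closedBall (0 : Euc N) R with hA
  have k1 : |speed c0 c1 A x s - speed c0 c1 A x0 s| ≤ ε / 3 := by
    refine ((hd.speed_lipBound hs inter_subset_right).abs_le x x0).trans ?_
    rw [le_div_iff₀ (by positivity)] at b2
    rw [← hV]; linarith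
  have k2 : |speed c0 c1 A x0 s - speed c0 c1 A x0 t0| ≤ ε / 3 :=
    (hd.speed_sub_time hs ht0 A x0).trans (hr b1 hs).le
  have k3 : |speed c0 c1 A x0 t0 - speed c0 c1 ({y | 0 ≤ w y} ∩ closedBall 0 R) x0 t0|
      ≤ ε / 3 := by
    refine (abs_speed_sub_le hd hA rfl hme (hw.inter measurableSet_closedBall) b3 ht0 x0).trans ?_
    have e1 := mul_le_mul_of_nonneg_left
      (hband (ε / (3 * (2 * B * (M + 1)))) (by positivity)) (by positivity : 0 ≤ 2 * B)
    have e2 : 2 * B * (M * (ε / (3 * (2 * B * (M + 1))))) = ε / 3 * (M / (M + 1)) := by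
      field_simp
    have e3 : M / (M + 1) ≤ 1 := by rw [div_le_one (by positivity)]; linarith
    rw [e2] at e1
    exact e1.trans (mul_le_of_le_one_right (by positivity) e3)
  have := abs_le.1 k1
  have := abs_le.1 k2
  have := abs_le.1 k3
  rw [abs_le]
  constructor <;> linarith

namespace IsLimit

variable {T L B Λ K C m R η s0 δ0 M : ℝ} {c0 c1 : Euc N → ℝ → ℝ} {u0 : Euc N → ℝ}
    {l : Filter ℕ} {τ : ℕ → ℝ} {v : ℕ → Euc N → ℝ → ℝ} {u : Euc N → ℝ → ℝ}

lemma exists_speed_close [l.NeBot] (h : IsLimit T K C m R η s0 δ0 c0 c1 u0 l τ v u)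
    (hd : SpeedData T L B Λ c0 c1) (hK : 0 ≤ K) (hC : 0 ≤ C) (hM : 0 ≤ M) {t0 : ℝ}
    (ht0 : t0 ∈ Icc 0 T)
    (hband : ∀ δ > 0, volume.real ({x | |u x t0| ≤ δ} ∩ closedBall 0 R) ≤ M * δ)
    (x0 : Euc N) {ε : ℝ} (hε : 0 < ε) :
    ∃ r > 0, ∀ᶠ n in l, ∀ s ∈ Icc 0 T, |s - t0| ≤ r → ∀ x, ‖x - x0‖ ≤ r →
      |speed c0 c1 ({y | 0 ≤ v n y s} ∩ closedBall 0 R) x s -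
        speed c0 c1 ({y | 0 ≤ u y t0} ∩ closedBall 0 R) x0 t0| ≤ ε := by
  obtain ⟨r, hr, hr'⟩ := Dislocation.exists_speed_close hd (measurableSet_superlevel (h.lip ht0)) hM
    hband x0 ht0 hε
  refine ⟨min r (r / (3 * (K * C + 1))), by positivity, ?_⟩
  have hτ : ∀ᶠ n in l, τ n < r / (3 * (K * C + 1)) := h.zero.eventually (gt_mem_nhds (by positivity))
  filter_upwards [h.approx, hτ, h.pos,
    h.close hK ht0 (isCompact_closedBall 0 R) (by positivity : 0 < r / 3)] with n hn hτn hp hcl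
  intro s hs hst x hx
  refine hr' s hs (hst.trans (min_le_left _ _)) x (hx.trans (min_le_left _ _)) (fun y => v n y s)
    (measurableSet_superlevel (hn.lip s hs)) fun y hy => ?_
  have hst' := hst.trans (min_le_right _ _)
  have key : |v n y s - v n y t0| ≤ K * C * (|s - t0| + τ n) := by
    rcases le_total s t0 with hle | hle
    · have h1 := hn.mono y s hs t0 ht0 hle
      have h2 := hn.time y s hs t0 ht0 hle
      rw [abs_of_nonpos (by linarith), abs_of_nonpos (by linarith)]
      linarith
    · have h1 := hn.mono y t0 ht0 s hs hle
      have h2 := hn.time y t0 ht0 s hs hle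
      rw [abs_of_nonneg (by linarith), abs_of_nonneg (by linarith)]
      linarith
  have key2 : K * C * (|s - t0| + τ n) ≤ 2 * r / 3 := by
    rw [le_div_iff₀ (by positivity)] at hst'
    rw [lt_div_iff₀ (by positivity)] at hτn
    have hKC : 0 ≤ K * C := by positivity
    have := abs_nonneg (s - t0)
    nlinarith
  have a1 := abs_le.1 (key.trans key2)
  have a2 := abs_le.1 (hcl y hy)
  rw [abs_le]
  constructor <;> linarith

/-- Backward dynamic programming for the limit. -/
lemma back [l.NeBot] (h : IsLimit T K C m R η s0 δ0 c0 c1 u0 l τ v u)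
    (hd : SpeedData T L B Λ c0 c1) (hK : 0 ≤ K) (hC : 0 ≤ C) (hM : 0 ≤ M) {t0 : ℝ}
    (ht0 : t0 ∈ Ioo 0 T)
    (hband : ∀ δ > 0, volume.real ({x | |u x t0| ≤ δ} ∩ closedBall 0 R) ≤ M * δ)
    (x0 : Euc N) {ε : ℝ} (hε : 0 < ε) :
    ∀ᶠ k in 𝓝[>] (0 : ℝ), ∃ y,
      ‖y - x0‖ ≤ k * (speed c0 c1 ({y | 0 ≤ u y t0} ∩ closedBall 0 R) x0 t0 + ε) ∧
      u x0 t0 ≤ u y (t0 - k) + k * ε := by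
  have ht0' : t0 ∈ Icc 0 T := Ioo_subset_Icc_self ht0
  obtain ⟨r, hr, hr'⟩ := h.exists_speed_close hd hK hC hM ht0' hband x0 (half_pos hε)
  set c := speed c0 c1 ({y | 0 ≤ u y t0} ∩ closedBall 0 R) x0 t0 with hc
  have hc0 : 0 ≤ c := hd.speed_nonneg ht0' _ _
  have hk0 : 0 < min t0 (min (r / 2) (r / (2 * (c + ε)))) := by
    have := ht0.1; positivity
  filter_upwards [Ioo_mem_nhdsGT hk0] with k hk
  have hkp := hk.1
  have hk1 := hk.2.trans_le (min_le_left _ _)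
  have hk2 := hk.2.trans_le ((min_le_right _ _).trans (min_le_left _ _))
  have hk3 := hk.2.trans_le ((min_le_right _ _).trans (min_le_right _ _))
  rw [lt_div_iff₀ (by positivity)] at hk3
  have hs : t0 - k ∈ Icc 0 T := ⟨by linarith, by linarith [ht0.2]⟩
  have hτ : ∀ᶠ n in l, τ n < min k (k * (ε / 2) / (c + ε / 2)) :=
    h.zero.eventually (gt_mem_nhds (by positivity))
  have hv0 : ∀ᶠ n in l, |v n x0 t0 - u x0 t0| ≤ k * ε / 2 := by
    filter_upwards [h.close hK ht0' (isCompact_singleton (x := x0)) (by positivity : 0 < k * ε / 2)]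
      with n hn using hn x0 rfl
  obtain ⟨n, hn, hτn, hp, hcl, hvn, hsp⟩ := (h.approx.and (hτ.and (h.pos.and
    ((h.close hK hs (isCompact_closedBall x0 (k * (c + ε)))
      (by positivity : 0 < k * ε / 2)).and (hv0.and hr'))))).exists
  have hτ1 := hτn.trans_le (min_le_left _ _)
  have hτ2 := hτn.trans_le (min_le_right _ _)
  rw [lt_div_iff₀ (by positivity)] at hτ2
  have hrad : (t0 - (t0 - k) + τ n) * (c + ε / 2) ≤ k * (c + ε) := by linarith
  obtain ⟨y, hy, he⟩ := hn.back x0 (t0 - k) hs t0 ht0' (by linarith) (c + ε / 2) (by positivity) (by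
    intro s' hs' h1 h2 x hx
    have := (abs_le.1 (hsp s' hs' (abs_le.2 ⟨by linarith, by linarith⟩) x (by
      have := hx.trans hrad; linarith))).2
    linarith)
  have hy' := hy.trans hrad
  refine ⟨y, hy', ?_⟩
  have a1 := abs_le.1 (hcl y (by rwa [mem_closedBall, dist_eq_norm]))
  have a2 := abs_le.1 hvn
  linarith

/-- Forward dynamic programming for the limit. -/
lemma forward [l.NeBot] (h : IsLimit T K C m R η s0 δ0 c0 c1 u0 l τ v u)
    (hd : SpeedData T L B Λ c0 c1) (hK : 0 ≤ K) (hC : 0 ≤ C) (hM : 0 ≤ M) {t0 : ℝ}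
    (ht0 : t0 ∈ Ioo 0 T)
    (hband : ∀ δ > 0, volume.real ({x | |u x t0| ≤ δ} ∩ closedBall 0 R) ≤ M * δ)
    (x0 : Euc N) {ε : ℝ} (hε : 0 < ε) :
    ∀ᶠ k in 𝓝[>] (0 : ℝ), ∀ y,
      ‖y - x0‖ ≤ k * max (speed c0 c1 ({y | 0 ≤ u y t0} ∩ closedBall 0 R) x0 t0 - ε) 0 →
      u y (t0 - k) ≤ u x0 t0 + k * ε := by
  have ht0' : t0 ∈ Icc 0 T := Ioo_subset_Icc_self ht0
  obtain ⟨r, hr, hr'⟩ := h.exists_speed_close hd hK hC hM ht0' hband x0 (half_pos hε)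
  set c := speed c0 c1 ({y | 0 ≤ u y t0} ∩ closedBall 0 R) x0 t0 with hc
  have hc0 : 0 ≤ c := hd.speed_nonneg ht0' _ _
  have hk0 : 0 < min t0 (min (r / 2) (r / (2 * (c + ε)))) := by
    have := ht0.1; positivity
  filter_upwards [Ioo_mem_nhdsGT hk0] with k hk
  have hkp := hk.1
  have hk1 := hk.2.trans_le (min_le_left _ _)
  have hk2 := hk.2.trans_le ((min_le_right _ _).trans (min_le_left _ _))
  have hk3 := hk.2.trans_le ((min_le_right _ _).trans (min_le_right _ _))
  rw [lt_div_iff₀ (by positivity)] at hk3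
  have hs : t0 - k ∈ Icc 0 T := ⟨by linarith, by linarith [ht0.2]⟩
  intro y hy
  rcases le_or_gt (c - ε) 0 with hneg | hcpos
  · rw [max_eq_right hneg, mul_zero] at hy
    have : y = x0 := by simpa [sub_eq_zero] using hy
    rw [this]
    have := h.mono hs ht0' (by linarith) x0
    have : 0 ≤ k * ε := by positivity
    linarith
  rw [max_eq_left hcpos.le] at hy
  have hcε : 0 < c - ε / 2 := by linarith
  have hτ : ∀ᶠ n in l, τ n < min k (k * (ε / 2) / (c - ε / 2)) :=
    h.zero.eventually (gt_mem_nhds (by positivity))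
  have hv : ∀ x, ∀ t ∈ Icc 0 T, ∀ᶠ n in l, |v n x t - u x t| ≤ k * ε / 2 := by
    intro x t ht
    filter_upwards [h.close hK ht (isCompact_singleton (x := x)) (by positivity : 0 < k * ε / 2)]
      with n hn using hn x rfl
  obtain ⟨n, hn, hτn, hp, hvy, hvx, hsp⟩ := (h.approx.and (hτ.and (h.pos.and
    ((hv y (t0 - k) hs).and ((hv x0 t0 ht0').and hr'))))).exists
  have hτ1 := hτn.trans_le (min_le_left _ _)
  have hτ2 := hτn.trans_le (min_le_right _ _)
  rw [lt_div_iff₀ hcε] at hτ2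
  have := hn.forward x0 (t0 - k) hs t0 ht0' (by linarith) (c - ε / 2) hcε.le (by
    intro s' hs' h1 h2 x hx
    have := (abs_le.1 (hsp s' hs' (abs_le.2 ⟨by linarith, by linarith⟩) x (by
      have : k * ε > 0 := by positivity
      linarith))).1
    linarith) y (by linarith)
  have a1 := abs_le.1 hvy
  have a2 := abs_le.1 hvx
  linarith

end IsLimit

lemma exists_taylor {φ : Euc N → ℝ → ℝ} (hφ : ContDiff ℝ 1 (fun p : Euc N × ℝ => φ p.1 p.2))
    (x0 : Euc N) (t0 : ℝ) {ε : ℝ} (hε : 0 < ε) :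
    ∃ r > 0, ∀ x t, ‖x - x0‖ < r → |t - t0| < r →
      |φ x t - φ x0 t0 - (⟪gradient (fun x => φ x t0) x0, x - x0⟫ + deriv (φ x0) t0 * (t - t0))| ≤
        ε * (‖x - x0‖ + |t - t0|) := by
  have hD := (hφ.differentiable one_ne_zero (x0, t0)).hasFDerivAt
  set D := fderiv ℝ (fun p : Euc N × ℝ => φ p.1 p.2) (x0, t0) with hDdef
  have h1 : HasFDerivAt (fun x => φ x t0) (D.comp (ContinuousLinearMap.inl ℝ (Euc N) ℝ)) x0 :=
    HasFDerivAt.comp (g := fun p : Euc N × ℝ => φ p.1 p.2) (f := fun x => (x, t0)) x0 hD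
      (hasFDerivAt_prodMk_left x0 t0)
  have h2 : HasFDerivAt (φ x0) (D.comp (ContinuousLinearMap.inr ℝ (Euc N) ℝ)) t0 :=
    hD.comp t0 (hasFDerivAt_prodMk_right x0 t0)
  have h1' : ∀ z, D (z, 0) = ⟪gradient (fun x => φ x t0) x0, z⟫ := by
    intro z
    rw [gradient, InnerProductSpace.toDual_symm_apply, h1.fderiv]
    rfl
  have h2' : ∀ s, D (0, s) = deriv (φ x0) t0 * s := by
    intro s
    rw [h2.hasDerivAt.deriv]
    have : ((0 : Euc N), s) = s • ((0 : Euc N), (1 : ℝ)) := by simp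
    rw [this, map_smul, smul_eq_mul, mul_comm]
    rfl
  have ho := hD.isLittleO.def hε
  obtain ⟨r, hr, hr'⟩ := Metric.eventually_nhds_iff.1 ho
  refine ⟨r, hr, fun x t hx ht => ?_⟩
  have := hr' (y := (x, t)) (by
    rw [Prod.dist_eq, max_lt_iff, dist_eq_norm, Real.dist_eq]; exact ⟨hx, ht⟩)
  have e : D ((x, t) - (x0, t0)) =
      ⟪gradient (fun x => φ x t0) x0, x - x0⟫ + deriv (φ x0) t0 * (t - t0) := by
    rw [← h1', ← h2', ← map_add]; simp
  rw [e, Real.norm_eq_abs] at this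
  refine this.trans (mul_le_mul_of_nonneg_left ?_ hε.le)
  rw [Prod.mk_sub_mk, Prod.norm_mk, Real.norm_eq_abs]
  exact max_le (by linarith [abs_nonneg (t - t0)]) (by linarith [norm_nonneg (x - x0)])

lemma exists_of_isLocalMaxOn {T : ℝ} {f : Euc N → ℝ → ℝ} {x0 : Euc N} {t0 : ℝ}
    (h : IsLocalMaxOn (fun p : Euc N × ℝ => f p.1 p.2) (univ ×ˢ Icc 0 T) (x0, t0)) :
    ∃ r > 0, ∀ x, ∀ t ∈ Icc 0 T, ‖x - x0‖ < r → |t - t0| < r → f x t ≤ f x0 t0 := by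
  obtain ⟨r, hr, hr'⟩ := Metric.eventually_nhds_iff.1 (eventually_nhdsWithin_iff.1 h)
  refine ⟨r, hr, fun x t ht h1 h2 => hr' (y := (x, t)) ?_ ⟨mem_univ _, ht⟩⟩
  rw [Prod.dist_eq, max_lt_iff, dist_eq_norm, Real.dist_eq]; exact ⟨h1, h2⟩

lemma deriv_le_of_back {T c : ℝ} {u φ : Euc N → ℝ → ℝ} {x0 : Euc N} {t0 : ℝ} (ht0 : t0 ∈ Ioo 0 T)
    (hc : 0 ≤ c)
    (hback : ∀ ε > 0, ∀ᶠ k in 𝓝[>] (0 : ℝ), ∃ y, ‖y - x0‖ ≤ k * (c + ε) ∧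
      u x0 t0 ≤ u y (t0 - k) + k * ε)
    (hφ : ContDiff ℝ 1 (fun p : Euc N × ℝ => φ p.1 p.2))
    (hmax : IsLocalMaxOn (fun p : Euc N × ℝ => u p.1 p.2 - φ p.1 p.2) (univ ×ˢ Icc 0 T) (x0, t0)) :
    deriv (φ x0) t0 ≤ c * ‖gradient (fun x => φ x t0) x0‖ := by
  obtain ⟨r, hr, hr'⟩ := exists_of_isLocalMaxOn (f := fun x t => u x t - φ x t) hmax
  set p := gradient (fun x => φ x t0) x0 with hp
  set a := deriv (φ x0) t0 with ha
  have key : ∀ ε ∈ Ioo (0 : ℝ) 1, a ≤ c * ‖p‖ + ε * (‖p‖ + 1 + (c + 2)) := by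
    intro ε hε
    have hε0 := hε.1
    have hε1 := hε.2
    obtain ⟨r2, hr2, ht⟩ := exists_taylor hφ x0 t0 hε0
    rw [← hp, ← ha] at ht
    have hk0 : 0 < min t0 (min r r2 / (c + 2)) := by
      have := ht0.1; positivity
    obtain ⟨k, ⟨y, hy, hu⟩, hk⟩ := ((hback ε hε0).and (Ioo_mem_nhdsGT hk0)).exists
    have hkp := hk.1
    have hk1 := hk.2.trans_le (min_le_left _ _)
    have hk2 := hk.2.trans_le (min_le_right _ _)
    rw [lt_div_iff₀ (by positivity), lt_min_iff] at hk2
    have hkc : 0 ≤ k * c := by positivity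
    have hkε : k * ε < k := mul_lt_of_lt_one_right hkp hε1
    have hkabs : |t0 - k - t0| = k := by
      rw [show t0 - k - t0 = -k by ring, abs_neg, abs_of_pos hkp]
    have h1 := hr' y (t0 - k) ⟨by linarith, by linarith [ht0.2]⟩ (by linarith) (by
      rw [hkabs]; linarith)
    have h2 := (abs_le.1 (ht y (t0 - k) (by linarith) (by rw [hkabs]; linarith))).2
    rw [hkabs] at h2
    have h3 := (abs_le.1 (abs_real_inner_le_norm p (y - x0))).1
    have h3' := (abs_le.1 (abs_real_inner_le_norm p (y - x0))).2
    have h4 := mul_le_mul_of_nonneg_left hy (norm_nonneg p)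
    have h5 : ε * (‖y - x0‖ + k) ≤ ε * (k * (c + 2)) :=
      mul_le_mul_of_nonneg_left (by linarith) hε0.le
    have h6 : k * a ≤ k * (c * ‖p‖ + ε * (‖p‖ + 1 + (c + 2))) := by linarith
    exact le_of_mul_le_mul_left h6 hkp
  have hlim : Tendsto (fun ε : ℝ => c * ‖p‖ + ε * (‖p‖ + 1 + (c + 2))) (𝓝[>] 0)
      (𝓝 (c * ‖p‖ + 0 * (‖p‖ + 1 + (c + 2)))) :=
    ((by fun_prop : Continuous fun ε : ℝ => c * ‖p‖ + ε * (‖p‖ + 1 + (c + 2))).tendsto 0).mono_left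
      nhdsWithin_le_nhds
  rw [zero_mul, add_zero] at hlim
  exact ge_of_tendsto hlim (by filter_upwards [Ioo_mem_nhdsGT one_pos] with ε hε using key ε hε)

lemma le_deriv_of_forward {T c : ℝ} {u φ : Euc N → ℝ → ℝ} {x0 : Euc N} {t0 : ℝ}
    (ht0 : t0 ∈ Ioo 0 T) (hc : 0 ≤ c)
    (hfwd : ∀ ε > 0, ∀ᶠ k in 𝓝[>] (0 : ℝ), ∀ y, ‖y - x0‖ ≤ k * max (c - ε) 0 →
      u y (t0 - k) ≤ u x0 t0 + k * ε)
    (hφ : ContDiff ℝ 1 (fun p : Euc N × ℝ => φ p.1 p.2))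
    (hmin : IsLocalMinOn (fun p : Euc N × ℝ => u p.1 p.2 - φ p.1 p.2) (univ ×ˢ Icc 0 T) (x0, t0)) :
    c * ‖gradient (fun x => φ x t0) x0‖ ≤ deriv (φ x0) t0 := by
  obtain ⟨r, hr, hr'⟩ := exists_of_isLocalMaxOn (f := fun x t => -(u x t - φ x t)) hmin.neg
  set p := gradient (fun x => φ x t0) x0 with hp
  set a := deriv (φ x0) t0 with ha
  have key : ∀ ε ∈ Ioo (0 : ℝ) 1, c * ‖p‖ ≤ a + ε * (‖p‖ + 1 + (c + 1)) := by
    intro ε hε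
    have hε0 := hε.1
    have hε1 := hε.2
    obtain ⟨r2, hr2, ht⟩ := exists_taylor hφ x0 t0 hε0
    rw [← hp, ← ha] at ht
    have hk0 : 0 < min t0 (min r r2 / (c + 2)) := by
      have := ht0.1; positivity
    obtain ⟨k, hu, hk⟩ := ((hfwd ε hε0).and (Ioo_mem_nhdsGT hk0)).exists
    have hkp := hk.1
    have hk1 := hk.2.trans_le (min_le_left _ _)
    have hk2 := hk.2.trans_le (min_le_right _ _)
    rw [lt_div_iff₀ (by positivity), lt_min_iff] at hk2
    have hkc : 0 ≤ k * c := by positivity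
    have hkabs : |t0 - k - t0| = k := by
      rw [show t0 - k - t0 = -k by ring, abs_neg, abs_of_pos hkp]
    set b := max (c - ε) 0 with hb
    have hb0 : 0 ≤ b := le_max_right _ _
    have hbc : b ≤ c := max_le (by linarith) hc
    have hbc' : c - ε ≤ b := le_max_left _ _
    set e := ‖p‖⁻¹ • p with he
    have he1 : ‖e‖ ≤ 1 := by
      rw [he, norm_smul, norm_inv, norm_norm]; exact inv_mul_le_one
    have hpe : ⟪p, e⟫ = ‖p‖ := by
      rw [he, inner_smul_right, real_inner_self_eq_norm_sq]
      rcases eq_or_ne ‖p‖ 0 with h | h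
      · simp [h]
      · field_simp
    have hkb : 0 ≤ k * b := by positivity
    have hnorm : ‖x0 + (k * b) • e - x0‖ ≤ k * b := by
      rw [add_sub_cancel_left, norm_smul, Real.norm_of_nonneg hkb]
      exact mul_le_of_le_one_right hkb he1
    have hkb' : k * b ≤ k * c := mul_le_mul_of_nonneg_left hbc hkp.le
    have h0 := hu _ hnorm
    have h1 := hr' (x0 + (k * b) • e) (t0 - k) ⟨by linarith, by linarith [ht0.2]⟩ (by linarith) (by
      rw [hkabs]; linarith)
    have h2 := (abs_le.1 (ht (x0 + (k * b) • e) (t0 - k) (by linarith)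
      (by rw [hkabs]; linarith))).1
    rw [hkabs] at h2
    have h5 : ε * (‖x0 + (k * b) • e - x0‖ + k) ≤ ε * (k * (c + 1)) :=
      mul_le_mul_of_nonneg_left (by linarith) hε0.le
    rw [show ⟪p, x0 + (k * b) • e - x0⟫ = k * b * ‖p‖ by
      rw [add_sub_cancel_left, inner_smul_right, hpe]] at h2
    have h7 := mul_le_mul_of_nonneg_left (mul_le_mul_of_nonneg_right hbc' (norm_nonneg p)) hkp.le
    have h6 : k * (c * ‖p‖) ≤ k * (a + ε * (‖p‖ + 1 + (c + 1))) := by linarith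
    exact le_of_mul_le_mul_left h6 hkp
  have hlim : Tendsto (fun ε : ℝ => a + ε * (‖p‖ + 1 + (c + 1))) (𝓝[>] 0)
      (𝓝 (a + 0 * (‖p‖ + 1 + (c + 1)))) :=
    ((by fun_prop : Continuous fun ε : ℝ => a + ε * (‖p‖ + 1 + (c + 1))).tendsto 0).mono_left
      nhdsWithin_le_nhds
  rw [zero_mul, add_zero] at hlim
  exact ge_of_tendsto hlim (by filter_upwards [Ioo_mem_nhdsGT one_pos] with ε hε using key ε hε)

/-- Viscosity subsolutions of `u_t = c |Du|`. -/
def IsSub (T : ℝ) (c w : Euc N → ℝ → ℝ) : Prop :=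
  ∀ φ : Euc N → ℝ → ℝ, ContDiff ℝ 1 (fun p : Euc N × ℝ => φ p.1 p.2) →
    ∀ x0 : Euc N, ∀ t0 ∈ Ioo 0 T,
      IsLocalMaxOn (fun p : Euc N × ℝ => w p.1 p.2 - φ p.1 p.2) (univ ×ˢ Icc 0 T) (x0, t0) →
        deriv (φ x0) t0 ≤ c x0 t0 * ‖gradient (fun x => φ x t0) x0‖

/-- Viscosity supersolutions of `u_t = c |Du|`. -/
def IsSuper (T : ℝ) (c w : Euc N → ℝ → ℝ) : Prop :=
  ∀ φ : Euc N → ℝ → ℝ, ContDiff ℝ 1 (fun p : Euc N × ℝ => φ p.1 p.2) →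
    ∀ x0 : Euc N, ∀ t0 ∈ Ioo 0 T,
      IsLocalMinOn (fun p : Euc N × ℝ => w p.1 p.2 - φ p.1 p.2) (univ ×ˢ Icc 0 T) (x0, t0) →
        c x0 t0 * ‖gradient (fun x => φ x t0) x0‖ ≤ deriv (φ x0) t0

lemma norm_gradient_neg (f : Euc N → ℝ) (x : Euc N) :
    ‖gradient (fun y => -f y) x‖ = ‖gradient f x‖ := by
  simp only [gradient, LinearIsometryEquiv.norm_map]
  rw [fderiv_fun_neg, norm_neg]

lemma IsSuper.neg {T : ℝ} {c w : Euc N → ℝ → ℝ} (h : IsSuper T c w) :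
    IsSub T (fun x t => -c x t) (fun x t => -w x t) := by
  intro φ hφ x0 t0 ht0 hm
  have h1 := h (fun x t => -φ x t) hφ.neg x0 t0 ht0 (by
    filter_upwards [hm] with p hp
    linarith)
  rw [norm_gradient_neg, deriv.fun_neg] at h1
  linarith

lemma IsSub.neg {T : ℝ} {c w : Euc N → ℝ → ℝ} (h : IsSub T c w) :
    IsSuper T (fun x t => -c x t) (fun x t => -w x t) := by
  intro φ hφ x0 t0 ht0 hm
  have h1 := h (fun x t => -φ x t) hφ.neg x0 t0 ht0 (by
    filter_upwards [hm] with p hp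
    linarith)
  rw [norm_gradient_neg, deriv.fun_neg] at h1
  linarith

/-- A smooth function touching a Lipschitz function from below inherits the Lipschitz bound. -/
lemma norm_gradient_le {T K : ℝ} {w φ : Euc N → ℝ → ℝ} {x0 : Euc N} {t0 : ℝ}
    (hK : 0 ≤ K) (ht0 : t0 ∈ Icc 0 T) (hw : LipBound K (fun x => w x t0))
    (hφ : ContDiff ℝ 1 (fun p : Euc N × ℝ => φ p.1 p.2))
    (hmin : IsLocalMinOn (fun p : Euc N × ℝ => w p.1 p.2 - φ p.1 p.2) (univ ×ˢ Icc 0 T) (x0, t0)) :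
    ‖gradient (fun x => φ x t0) x0‖ ≤ K := by
  obtain ⟨r, hr, hr'⟩ := exists_of_isLocalMaxOn (f := fun x t => -(w x t - φ x t)) hmin.neg
  set p := gradient (fun x => φ x t0) x0 with hp
  refine le_of_forall_pos_le_add fun ε hε => ?_
  obtain ⟨r2, hr2, ht⟩ := exists_taylor hφ x0 t0 hε
  rw [← hp] at ht
  rcases (norm_nonneg p).eq_or_lt with h0 | h0
  · rw [← h0]; positivity
  set k := min r r2 / (2 * ‖p‖) with hk
  have hk0 : 0 < k := by positivity
  have hkp : k * ‖p‖ = min r r2 / 2 := by rw [hk]; field_simp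
  have hmin0 : 0 < min r r2 := by positivity
  have hn : ‖x0 + k • p - x0‖ = k * ‖p‖ := by
    rw [add_sub_cancel_left, norm_smul, Real.norm_of_nonneg hk0.le]
  have h1 := hr' (x0 + k • p) t0 ht0 (by rw [hn]; linarith [min_le_left r r2]) (by simpa using hr)
  have h2 := (abs_le.1 (ht (x0 + k • p) t0 (by rw [hn]; linarith [min_le_right r r2])
    (by simpa using hr2))).1
  have h3 := hw (x0 + k • p) x0
  rw [hn] at h3 h2
  rw [add_sub_cancel_left, inner_smul_right, real_inner_self_eq_norm_sq, sub_self, abs_zero] at h2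
  have h4 : (k * ‖p‖) * ‖p‖ ≤ (k * ‖p‖) * (K + ε) := by
    simp only at h3
    linarith
  exact le_of_mul_le_mul_left h4 (by positivity)

lemma hasGradientAt_norm_sub_sq (x y : Euc N) :
    HasGradientAt (fun z => ‖z - y‖ ^ 2) ((2 : ℝ) • (x - y)) x := by
  rw [hasGradientAt_iff_hasFDerivAt]
  have := ((hasFDerivAt_id (𝕜 := ℝ) x).sub_const y).norm_sq
  refine this.congr_fderiv ?_
  ext z
  simp

/-- Gradient of the test functions used in the comparison argument. -/
lemma gradient_test (α β k a b : ℝ) (x y x0 : Euc N) :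
    gradient (fun z => α * (‖z - y‖ ^ 2 + a) + β * Real.exp (k * (‖z - x0‖ ^ 2 + b))) x =
      (2 * α) • (x - y) + (2 * k * (β * Real.exp (k * (‖x - x0‖ ^ 2 + b)))) • (x - x0) := by
  apply HasGradientAt.gradient
  rw [hasGradientAt_iff_hasFDerivAt]
  have h1 := (hasGradientAt_iff_hasFDerivAt.1 (hasGradientAt_norm_sub_sq x y)).add_const a
  have h2 := (hasGradientAt_iff_hasFDerivAt.1 (hasGradientAt_norm_sub_sq x x0)).add_const b
  refine ((h1.const_mul α).add ((h2.const_mul k).exp.const_mul β)).congr_fderiv ?_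
  ext z
  simp
  ring

lemma deriv_test (α β k a b C R : ℝ) (s t : ℝ) :
    deriv (fun t' => α * (a + (t' - s) ^ 2) + β * Real.exp (k * (b + (C * t' - R)))) t =
      2 * α * (t - s) + k * C * (β * Real.exp (k * (b + (C * t - R)))) := by
  have h1 := ((((hasDerivAt_id t).sub_const s).pow 2).const_add a).const_mul α
  have h2 := ((((((hasDerivAt_id t).const_mul C).sub_const R).const_add b).const_mul k).exp).const_mul β
  refine (h1.add h2).deriv.trans ?_
  simp
  ring

lemma contDiff_test (α β k C R s : ℝ) (y x0 : Euc N) :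
    ContDiff ℝ 1 (fun p : Euc N × ℝ => α * (‖p.1 - y‖ ^ 2 + (p.2 - s) ^ 2) +
      β * Real.exp (k * (‖p.1 - x0‖ ^ 2 + (C * p.2 - R)))) := by
  have h1 : ContDiff ℝ 1 (fun p : Euc N × ℝ => ‖p.1 - y‖ ^ 2) :=
    (contDiff_fst.sub contDiff_const).norm_sq ℝ
  have h2 : ContDiff ℝ 1 (fun p : Euc N × ℝ => ‖p.1 - x0‖ ^ 2) :=
    (contDiff_fst.sub contDiff_const).norm_sq ℝ
  fun_prop

/-- Barrier confining the maximum points in the comparison argument. -/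
lemma exists_barrier {κ M δ : ℝ} (hκ : 0 < κ) (hδ : 0 < δ) :
    ∃ k > 0, M < Real.exp (k * κ) ∧ Real.exp (k * -κ) < δ / 2 := by
  have hp : 0 < |M| + 2 / δ := by positivity
  refine ⟨(|M| + 2 / δ) / κ, by positivity, ?_, ?_⟩
  · rw [div_mul_cancel₀ _ hκ.ne']
    have := Real.add_one_le_exp (|M| + 2 / δ)
    have : 0 < 2 / δ := by positivity
    linarith [le_abs_self M]
  · rw [mul_neg, div_mul_cancel₀ _ hκ.ne', Real.exp_neg]
    rw [inv_lt_comm₀ (Real.exp_pos _) (by positivity), inv_div]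
    have := Real.add_one_le_exp (|M| + 2 / δ)
    linarith [abs_nonneg M]

/-- The viscosity inequalities at a pair of doubled maximum points. -/
lemma doubled_inequality {T C K k n C' R0 ρ : ℝ} {c w1 w2 : Euc N → ℝ → ℝ} (hK : 0 ≤ K)
    (hk : 0 < k) (hcC : ∀ x, ∀ t ∈ Ioo 0 T, |c x t| ≤ C) (h2x : ∀ t ∈ Icc 0 T, LipBound K (fun x => w2 x t))
    (h1 : IsSub T c w1) (h2 : IsSuper T c w2) {x0 x y : Euc N} {t s : ℝ}
    (hx : ‖x - x0‖ < ρ) (hy : ‖y - x0‖ < ρ) (ht : t ∈ Ioo 0 T) (hs : s ∈ Ioo 0 T)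
    (hmax : ∀ x' ∈ closedBall x0 ρ, ∀ t' ∈ Icc 0 T, ∀ y' ∈ closedBall x0 ρ, ∀ s' ∈ Icc 0 T,
      w1 x' t' - w2 y' s' - n * (‖x' - y'‖ ^ 2 + (t' - s') ^ 2)
          - Real.exp (k * (‖x' - x0‖ ^ 2 + (C' * t' - R0))) ≤
        w1 x t - w2 y s - n * (‖x - y‖ ^ 2 + (t - s) ^ 2)
          - Real.exp (k * (‖x - x0‖ ^ 2 + (C' * t - R0)))) :
    k * (C' - 2 * ρ * C) * Real.exp (k * (‖x - x0‖ ^ 2 + (C' * t - R0))) ≤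
      |c x t - c y s| * K := by
  set Φ := Real.exp (k * (‖x - x0‖ ^ 2 + (C' * t - R0))) with hΦ
  have hΦ0 : 0 < Φ := Real.exp_pos _
  have hxb : x ∈ closedBall x0 ρ := by rw [mem_closedBall, dist_eq_norm]; exact hx.le
  have hyb : y ∈ closedBall x0 ρ := by rw [mem_closedBall, dist_eq_norm]; exact hy.le
  have hnear : ∀ z : Euc N, ‖z - x0‖ < ρ → ∀ r : ℝ, ∀ᶠ q : Euc N × ℝ in 𝓝[univ ×ˢ Icc 0 T] (z, r),
      q.1 ∈ closedBall x0 ρ ∧ q.2 ∈ Icc 0 T := by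
    intro z hz r
    have : ∀ᶠ q : Euc N × ℝ in 𝓝 (z, r), q.1 ∈ ball x0 ρ :=
      continuousAt_fst.eventually (isOpen_ball.mem_nhds (by rwa [mem_ball, dist_eq_norm]))
    filter_upwards [nhdsWithin_le_nhds this, self_mem_nhdsWithin] with q hq hq'
    exact ⟨ball_subset_closedBall hq, hq'.2⟩
  have a1 := h1 (fun x' t' => n * (‖x' - y‖ ^ 2 + (t' - s) ^ 2) +
      1 * Real.exp (k * (‖x' - x0‖ ^ 2 + (C' * t' - R0)))) (contDiff_test _ _ _ _ _ _ _ _) x t ht (by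
    filter_upwards [hnear x hx t] with q hq
    have := hmax q.1 hq.1 q.2 hq.2 y hyb s (Ioo_subset_Icc_self hs)
    linarith)
  have hmin : IsLocalMinOn (fun p : Euc N × ℝ => w2 p.1 p.2 -
      ((-n) * (‖p.1 - x‖ ^ 2 + (p.2 - t) ^ 2) +
        0 * Real.exp (k * (‖p.1 - x0‖ ^ 2 + (C' * p.2 - R0))))) (univ ×ˢ Icc 0 T) (y, s) := by
    filter_upwards [hnear y hy s] with q hq
    have := hmax x hxb t (Ioo_subset_Icc_self ht) q.1 hq.1 q.2 hq.2
    rw [norm_sub_rev q.1 x, norm_sub_rev y x, show (q.2 - t) ^ 2 = (t - q.2) ^ 2 by ring,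
      show (s - t) ^ 2 = (t - s) ^ 2 by ring]
    linarith
  have a2 := h2 (fun x' t' => (-n) * (‖x' - x‖ ^ 2 + (t' - t) ^ 2) +
      0 * Real.exp (k * (‖x' - x0‖ ^ 2 + (C' * t' - R0)))) (contDiff_test _ _ _ _ _ _ _ _) y s hs
      hmin
  have a3 := norm_gradient_le (φ := fun x' t' => (-n) * (‖x' - x‖ ^ 2 + (t' - t) ^ 2) +
      0 * Real.exp (k * (‖x' - x0‖ ^ 2 + (C' * t' - R0)))) hK (Ioo_subset_Icc_self hs)
      (h2x s (Ioo_subset_Icc_self hs)) (contDiff_test _ _ _ _ _ _ _ _) hmin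
  rw [deriv_test, gradient_test] at a1 a2
  rw [gradient_test] at a3
  have e : (2 * -n) • (y - x) + (2 * k * (0 * Real.exp (k * (‖y - x0‖ ^ 2 + (C' * s - R0))))) •
      (y - x0) = (2 * n) • (x - y) := by
    rw [zero_mul, mul_zero, zero_smul, add_zero]; module
  rw [e] at a2 a3
  rw [one_mul, ← hΦ] at a1
  set p := (2 * n) • (x - y) with hp
  have hq : ‖(2 * k * Φ) • (x - x0)‖ ≤ 2 * k * Φ * ρ := by
    rw [norm_smul, Real.norm_of_nonneg (by positivity)]
    exact mul_le_mul_of_nonneg_left hx.le (by positivity)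
  have hd : |‖p + (2 * k * Φ) • (x - x0)‖ - ‖p‖| ≤ 2 * k * Φ * ρ := by
    refine (abs_norm_sub_norm_le _ _).trans ?_
    rwa [add_sub_cancel_left]
  have b1 : c x t * (‖p + (2 * k * Φ) • (x - x0)‖ - ‖p‖) ≤ C * (2 * k * Φ * ρ) := by
    refine (le_abs_self _).trans ?_
    rw [abs_mul]
    exact mul_le_mul (hcC x t ht) hd (abs_nonneg _) ((abs_nonneg _).trans (hcC x t ht))
  have b2 : (c x t - c y s) * ‖p‖ ≤ |c x t - c y s| * K :=
    mul_le_mul (le_abs_self _) a3 (norm_nonneg _) (abs_nonneg _)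
  linarith

/-- Comparison principle with finite speed of propagation. -/
theorem comparison {T C K ρ : ℝ} (hK : 0 ≤ K) (hC : 0 ≤ C) (hρ : 0 < ρ)
    {c w1 w2 : Euc N → ℝ → ℝ}
    (hc : ContinuousOn (fun p : Euc N × ℝ => c p.1 p.2) (univ ×ˢ Ioo 0 T))
    (hcC : ∀ x, ∀ t ∈ Ioo 0 T, |c x t| ≤ C)
    (hw1 : ContinuousOn (fun p : Euc N × ℝ => w1 p.1 p.2) (univ ×ˢ Icc 0 T))
    (hw2 : ContinuousOn (fun p : Euc N × ℝ => w2 p.1 p.2) (univ ×ˢ Icc 0 T))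
    (h2x : ∀ t ∈ Icc 0 T, LipBound K (fun x => w2 x t))
    (h1 : IsSub T c w1) (h2 : IsSuper T c w2) {x0 : Euc N}
    (hinit : ∀ x ∈ closedBall x0 ρ, w1 x 0 ≤ w2 x 0)
    (hCρ : (2 * ρ * C + 1) * T ≤ ρ ^ 2) {t0 : ℝ} (ht0 : t0 ∈ Ioo 0 T) :
    w1 x0 t0 ≤ w2 x0 t0 := by
  by_contra! hlt
  set δ := w1 x0 t0 - w2 x0 t0 with hδd
  have hδ : 0 < δ := sub_pos.2 hlt
  set C' := 2 * ρ * C + 1 with hC'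
  have hC'0 : 0 < C' := by positivity
  set R0 := C' * (t0 + T) / 2 with hR0
  set κ := C' * (T - t0) / 2 with hκd
  have hκ : 0 < κ := by
    have := mul_pos hC'0 (sub_pos.2 ht0.2)
    positivity
  set Q : Set (Euc N × ℝ) := closedBall x0 ρ ×ˢ Icc 0 T with hQ
  have hQc : IsCompact (Q ×ˢ Q) :=
    ((isCompact_closedBall x0 ρ).prod isCompact_Icc).prod
      ((isCompact_closedBall x0 ρ).prod isCompact_Icc)
  have hQs : Q ⊆ univ ×ˢ Icc 0 T := prod_mono_left (subset_univ _)
  have hf : ContinuousOn (fun q : (Euc N × ℝ) × (Euc N × ℝ) => w1 q.1.1 q.1.2 - w2 q.2.1 q.2.2)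
      (Q ×ˢ Q) :=
    (hw1.comp continuousOn_fst fun q hq => hQs hq.1).sub
      (hw2.comp continuousOn_snd fun q hq => hQs hq.2)
  obtain ⟨M, hM⟩ := hQc.exists_bound_of_continuousOn hf
  obtain ⟨k, hk, hkM, hkδ⟩ := exists_barrier (M := M) hκ hδ
  set Φ : (Euc N × ℝ) × (Euc N × ℝ) → ℝ :=
    fun q => Real.exp (k * (‖q.1.1 - x0‖ ^ 2 + (C' * q.1.2 - R0))) with hΦ
  have hΦc : Continuous Φ := by fun_prop
  set D : (Euc N × ℝ) × (Euc N × ℝ) → ℝ :=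
    fun q => ‖q.1.1 - q.2.1‖ ^ 2 + (q.1.2 - q.2.2) ^ 2 with hD
  have hDc : Continuous D := by fun_prop
  have hp0 : ((x0, t0), (x0, t0)) ∈ Q ×ˢ Q := by
    have : (x0, t0) ∈ Q := ⟨mem_closedBall_self hρ.le, Ioo_subset_Icc_self ht0⟩
    exact ⟨this, this⟩
  have hex : ∀ n : ℕ, ∃ q ∈ Q ×ˢ Q, ∀ q' ∈ Q ×ˢ Q,
      w1 q'.1.1 q'.1.2 - w2 q'.2.1 q'.2.2 - (n + 1 : ℝ) * D q' - Φ q' ≤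
        w1 q.1.1 q.1.2 - w2 q.2.1 q.2.2 - (n + 1 : ℝ) * D q - Φ q := fun n =>
    hQc.exists_isMaxOn ⟨_, hp0⟩
      ((hf.sub (hDc.const_smul (n + 1 : ℝ)).continuousOn).sub hΦc.continuousOn)
  choose q hqQ hqmax using hex
  have hval : ∀ n : ℕ, δ / 2 ≤
      w1 (q n).1.1 (q n).1.2 - w2 (q n).2.1 (q n).2.2 - (n + 1 : ℝ) * D (q n) - Φ (q n) := by
    intro n
    refine le_trans ?_ (hqmax n _ hp0)
    have e1 : D ((x0, t0), (x0, t0)) = 0 := by simp [hD]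
    have e2 : Φ ((x0, t0), (x0, t0)) = Real.exp (k * -κ) := by
      simp only [hΦ, sub_self, norm_zero]
      congr 2
      rw [hR0, hκd]; ring
    rw [e1, e2]
    simp only
    linarith
  have hD0 : ∀ p, 0 ≤ D p := fun p => by positivity
  have hΦ0 : ∀ p, 0 < Φ p := fun p => Real.exp_pos _
  have hDn : Tendsto (fun n => D (q n)) atTop (𝓝 0) := by
    have hlim : Tendsto (fun n : ℕ => M / ((n : ℝ) + 1)) atTop (𝓝 0) :=
      tendsto_const_nhds.div_atTop
        (tendsto_atTop_add_const_right _ _ tendsto_natCast_atTop_atTop)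
    refine squeeze_zero (fun n => hD0 _) (fun n => ?_) hlim
    rw [le_div_iff₀ (by positivity)]
    have := le_of_abs_le (hM (q n) (hqQ n))
    linarith [hval n, hΦ0 (q n)]
  obtain ⟨qb, hqb, σ, hσ, hlim⟩ := hQc.tendsto_subseq hqQ
  have hDb : D qb = 0 := tendsto_nhds_unique ((hDc.tendsto qb).comp hlim)
    (hDn.comp hσ.tendsto_atTop)
  have hfl : Tendsto (fun j => w1 (q (σ j)).1.1 (q (σ j)).1.2 - w2 (q (σ j)).2.1 (q (σ j)).2.2)
      atTop (𝓝 (w1 qb.1.1 qb.1.2 - w2 qb.2.1 qb.2.2)) :=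
    (hf qb hqb).tendsto.comp (tendsto_nhdsWithin_iff.2 ⟨hlim, Eventually.of_forall fun j => hqQ _⟩)
  have hvb : δ / 2 ≤ w1 qb.1.1 qb.1.2 - w2 qb.2.1 qb.2.2 - Φ qb := by
    refine ge_of_tendsto (hfl.sub ((hΦc.tendsto qb).comp hlim)) (Eventually.of_forall fun j => ?_)
    have := hval (σ j)
    have h3 : 0 ≤ ((σ j : ℕ) + 1 : ℝ) * D (q (σ j)) := mul_nonneg (by positivity) (hD0 _)
    simp only [Function.comp]
    linarith
  have hMb := le_of_abs_le (hM qb hqb)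
  obtain ⟨⟨xb, tb⟩, ⟨yb, sb⟩⟩ := qb
  simp only [hD] at hDb
  have ex : xb = yb := by
    have : ‖xb - yb‖ = 0 := by
      have := sq_nonneg (tb - sb)
      have := sq_nonneg ‖xb - yb‖
      exact pow_eq_zero_iff two_ne_zero |>.1 (by linarith)
    exact sub_eq_zero.1 (norm_eq_zero.1 this)
  have et : tb = sb := by
    have : tb - sb = 0 := by
      have := sq_nonneg (tb - sb)
      have := sq_nonneg ‖xb - yb‖
      exact pow_eq_zero_iff two_ne_zero |>.1 (by linarith)
    exact sub_eq_zero.1 this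
  subst ex et
  obtain ⟨⟨hxb, htb⟩, -⟩ := hqb
  simp only at hvb hMb hxb htb
  have hexp : ‖xb - x0‖ ^ 2 + (C' * tb - R0) < κ := by
    have : Real.exp (k * (‖xb - x0‖ ^ 2 + (C' * tb - R0))) < Real.exp (k * κ) := by
      simp only [hΦ] at hvb
      linarith
    exact lt_of_mul_lt_mul_left (Real.exp_lt_exp.1 this) hk.le
  have eκ : C' * T - R0 = κ := by rw [hR0, hκd]; ring
  have htT : tb < T := by
    have := sq_nonneg ‖xb - x0‖
    exact lt_of_mul_lt_mul_left (by linarith : C' * tb < C' * T) hC'0.le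
  have hxρ : ‖xb - x0‖ < ρ := by
    have := mul_nonneg hC'0.le htb.1
    exact lt_of_pow_lt_pow_left₀ 2 hρ.le (by linarith)
  have ht0' : 0 < tb := by
    rcases htb.1.eq_or_lt with h | h
    · have := hinit xb hxb
      rw [← h] at hvb
      linarith [hΦ0 ((xb, 0), (xb, 0))]
    · exact h
  have hcont : ContinuousAt (fun p : Euc N × ℝ => c p.1 p.2) (xb, tb) :=
    hc.continuousAt ((isOpen_univ.prod isOpen_Ioo).mem_nhds ⟨mem_univ _, ht0', htT⟩)
  have l1 : Tendsto (fun j => (q (σ j)).1) atTop (𝓝 (xb, tb)) := hlim.fst_nhds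
  have l2 : Tendsto (fun j => (q (σ j)).2) atTop (𝓝 (xb, tb)) := hlim.snd_nhds
  have hopen : ball x0 ρ ×ˢ Ioo 0 T ∈ 𝓝 (xb, tb) :=
    (isOpen_ball.prod isOpen_Ioo).mem_nhds ⟨by rwa [mem_ball, dist_eq_norm], ht0', htT⟩
  have hfin : k * Φ ((xb, tb), (xb, tb)) ≤
      |c xb tb - c xb tb| * K := by
    refine le_of_tendsto_of_tendsto (((hΦc.tendsto _).comp hlim).const_mul k)
      ((((hcont.tendsto.comp l1).sub (hcont.tendsto.comp l2)).abs).mul_const K) ?_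
    filter_upwards [l1.eventually hopen, l2.eventually hopen] with j hj1 hj2
    have h3 := doubled_inequality (n := (σ j : ℕ) + 1) (C' := C') (R0 := R0) hK hk hcC h2x h1 h2
      (x0 := x0) (ρ := ρ) (by simpa [dist_eq_norm] using hj1.1) (by simpa [dist_eq_norm] using hj2.1)
      hj1.2 hj2.2 (fun x' hx' t' ht' y' hy' s' hs' =>
        hqmax (σ j) ((x', t'), (y', s')) ⟨⟨hx', ht'⟩, hy', hs'⟩)
    rw [hC', add_sub_cancel_left, mul_one] at h3
    exact h3
  rw [sub_self, abs_zero, zero_mul] at hfin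
  linarith [mul_pos hk (hΦ0 ((xb, tb), (xb, tb)))]

lemma IsSub.mono {T : ℝ} {c c' w : Euc N → ℝ → ℝ} (h : IsSub T c w)
    (hc : ∀ x, ∀ t ∈ Ioo 0 T, c x t ≤ c' x t) : IsSub T c' w := fun φ hφ x0 t0 ht0 hm =>
  (h φ hφ x0 t0 ht0 hm).trans (mul_le_mul_of_nonneg_right (hc x0 t0 ht0) (norm_nonneg _))

lemma IsSuper.mono {T : ℝ} {c c' w : Euc N → ℝ → ℝ} (h : IsSuper T c w)
    (hc : ∀ x, ∀ t ∈ Ioo 0 T, c' x t ≤ c x t) : IsSuper T c' w := fun φ hφ x0 t0 ht0 hm =>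
  (mul_le_mul_of_nonneg_right (hc x0 t0 ht0) (norm_nonneg _)).trans (h φ hφ x0 t0 ht0 hm)

lemma LipBound.neg {K : ℝ} {w : Euc N → ℝ} (h : LipBound K w) : LipBound K (fun x => -w x) := by
  intro x y
  have := h y x
  rw [norm_sub_rev] at this
  simp only
  linarith

/-- Raising a Lipschitz supersolution in time absorbs a perturbation of the speed. -/
lemma IsSuper.add_time {T K : ℝ} {c w : Euc N → ℝ → ℝ} {g G : ℝ → ℝ} (h : IsSuper T c w)
    (hK : 0 ≤ K) (hw : ∀ t ∈ Icc 0 T, LipBound K (fun x => w x t))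
    (hG : ∀ t, HasDerivAt G (g t) t) (hg : Continuous g) (hg0 : ∀ t ∈ Icc 0 T, 0 ≤ g t) :
    IsSuper T (fun x t => c x t + g t) (fun x t => w x t + K * G t) := by
  intro φ hφ x0 t0 ht0 hm
  have hG1 : ContDiff ℝ 1 G := by
    rw [contDiff_one_iff_deriv]
    exact ⟨fun t => (hG t).differentiableAt, by rwa [funext fun t => (hG t).deriv]⟩
  have hψ : ContDiff ℝ 1 (fun p : Euc N × ℝ => φ p.1 p.2 - K * G p.2) :=
    hφ.sub (contDiff_const.mul (hG1.comp contDiff_snd))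
  have hm' : IsLocalMinOn (fun p : Euc N × ℝ => w p.1 p.2 - (φ p.1 p.2 - K * G p.2))
      (univ ×ˢ Icc 0 T) (x0, t0) := by
    filter_upwards [hm] with p hp
    linarith
  have e : gradient (fun x => φ x t0 - K * G t0) x0 = gradient (fun x => φ x t0) x0 := by
    rw [gradient, gradient, fderiv_sub_const]
  have hφt : DifferentiableAt ℝ (φ x0) t0 :=
    ((hφ.comp (contDiff_prodMk_right x0)).differentiable one_ne_zero) t0
  have h1 := h (fun x t => φ x t - K * G t) hψ x0 t0 ht0 hm'
  have h2 := norm_gradient_le (φ := fun x t => φ x t - K * G t) hK (Ioo_subset_Icc_self ht0)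
    (hw t0 (Ioo_subset_Icc_self ht0)) hψ hm'
  rw [e] at h1 h2
  have e2 : deriv (fun t => φ x0 t - K * G t) t0 = deriv (φ x0) t0 - K * g t0 :=
    (hφt.hasDerivAt.sub ((hG t0).const_mul K)).deriv
  rw [e2] at h1
  have := mul_le_mul_of_nonneg_left h2 (hg0 t0 (Ioo_subset_Icc_self ht0))
  linarith

lemma le_add_of_speed_le {T K C C2 : ℝ} (hT : 0 < T) (hK : 0 ≤ K) (hC : 0 ≤ C) (hC2 : 0 ≤ C2)
    {c c' u v : Euc N → ℝ → ℝ} {g G : ℝ → ℝ}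
    (hc : ContinuousOn (fun p : Euc N × ℝ => c p.1 p.2) (univ ×ˢ Ioo 0 T))
    (hcC : ∀ x, ∀ t ∈ Ioo 0 T, |c x t| ≤ C)
    (hv : ContinuousOn (fun p : Euc N × ℝ => v p.1 p.2) (univ ×ˢ Icc 0 T))
    (hu : ContinuousOn (fun p : Euc N × ℝ => u p.1 p.2) (univ ×ˢ Icc 0 T))
    (hux : ∀ t ∈ Icc 0 T, LipBound K (fun x => u x t))
    (hvs : IsSub T c' v) (hus : IsSuper T c u) (h0 : ∀ x, v x 0 ≤ u x 0)
    (hG : ∀ t, HasDerivAt G (g t) t) (hg : Continuous g) (hG0 : G 0 = 0)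
    (hg0 : ∀ t ∈ Icc 0 T, 0 ≤ g t) (hgC : ∀ t ∈ Icc 0 T, g t ≤ C2)
    (hcc : ∀ x, ∀ t ∈ Ioo 0 T, c' x t ≤ c x t + g t) (x : Euc N) {t : ℝ} (ht : t ∈ Ioo 0 T) :
    v x t ≤ u x t + K * G t := by
  have hGc : Continuous G := continuous_iff_continuousAt.2 fun t => (hG t).continuousAt
  set ρ := 2 * (C + C2) * T + T + 1 with hρ
  have hp : 0 ≤ 2 * (C + C2) * T := by positivity
  have hρ1 : 1 ≤ ρ := by linarith
  refine comparison (c := fun x t => c x t + g t) (w2 := fun x t => u x t + K * G t) (C := C + C2)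
    (ρ := ρ) hK (by positivity) (by positivity)
    (hc.add (hg.comp continuous_snd).continuousOn) (fun x t ht => ?_) hv
    (hu.add ((hGc.comp continuous_snd).const_smul K).continuousOn) (fun t ht x y => ?_)
    (hvs.mono hcc) (hus.add_time hK hux hG hg hg0) (fun x _ => ?_) ?_ ht
  · have ht' := Ioo_subset_Icc_self ht
    refine (abs_add_le _ _).trans (add_le_add (hcC x t ht) ?_)
    rw [abs_of_nonneg (hg0 t ht')]
    exact hgC t ht'
  · have := hux t ht x y
    simp only at this ⊢
    linarith
  · rw [hG0, mul_zero, add_zero]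
    exact h0 x
  · have h1 : ρ ^ 2 = 2 * (C + C2) * T * ρ + (T + 1) * ρ := by rw [hρ]; ring
    have h2 : T + 1 ≤ (T + 1) * ρ := le_mul_of_one_le_right (by positivity) hρ1
    have h3 : (2 * ρ * (C + C2) + 1) * T = 2 * (C + C2) * T * ρ + T := by ring
    linarith

/-- Two solutions with close speeds stay close. -/
lemma abs_sub_le_of_speed_close {T K C C2 : ℝ} (hT : 0 < T) (hK : 0 ≤ K) (hC : 0 ≤ C)
    (hC2 : 0 ≤ C2) {c c' u v : Euc N → ℝ → ℝ} {g G : ℝ → ℝ}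
    (hc : ContinuousOn (fun p : Euc N × ℝ => c p.1 p.2) (univ ×ˢ Ioo 0 T))
    (hcC : ∀ x, ∀ t ∈ Ioo 0 T, |c x t| ≤ C)
    (hv : ContinuousOn (fun p : Euc N × ℝ => v p.1 p.2) (univ ×ˢ Icc 0 T))
    (hu : ContinuousOn (fun p : Euc N × ℝ => u p.1 p.2) (univ ×ˢ Icc 0 T))
    (hux : ∀ t ∈ Icc 0 T, LipBound K (fun x => u x t))
    (hv1 : IsSub T c' v) (hv2 : IsSuper T c' v) (hu1 : IsSub T c u) (hu2 : IsSuper T c u)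
    (h0 : ∀ x, v x 0 = u x 0)
    (hG : ∀ t, HasDerivAt G (g t) t) (hg : Continuous g) (hG0 : G 0 = 0)
    (hg0 : ∀ t ∈ Icc 0 T, 0 ≤ g t) (hgC : ∀ t ∈ Icc 0 T, g t ≤ C2)
    (hcc : ∀ x, ∀ t ∈ Ioo 0 T, |c' x t - c x t| ≤ g t) (x : Euc N) {t : ℝ} (ht : t ∈ Ioo 0 T) :
    |v x t - u x t| ≤ K * G t := by
  rw [abs_le]
  constructor
  · have := le_add_of_speed_le (c := fun x t => -c x t) (c' := fun x t => -c' x t)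
      (u := fun x t => -u x t) (v := fun x t => -v x t) hT hK hC hC2 hc.neg
      (fun x t ht => by rw [abs_neg]; exact hcC x t ht) hv.neg hu.neg (fun t ht => (hux t ht).neg)
      hv2.neg hu1.neg (fun x => by rw [h0]) hG hg hG0 hg0 hgC
      (fun x t ht => by linarith [(abs_le.1 (hcc x t ht)).1]) x ht
    linarith
  · have := le_add_of_speed_le hT hK hC hC2 hc hcC hv hu hux hv1 hu2 (fun x => (h0 x).le) hG hg hG0
      hg0 hgC (fun x t ht => by linarith [(abs_le.1 (hcc x t ht)).2]) x ht
    linarith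

lemma isSuper_const (T a : ℝ) (c : Euc N → ℝ → ℝ) : IsSuper T c (fun _ _ => a) := by
  intro φ hφ x0 t0 ht0 hm
  have h1 := norm_gradient_le (w := fun _ _ => a) le_rfl (Ioo_subset_Icc_self ht0) (fun x y => by simp) hφ hm
  have h2 : IsLocalMax (φ x0) t0 := by
    have ht : Tendsto (fun t : ℝ => (x0, t)) (𝓝 t0) (𝓝[univ ×ˢ Icc 0 T] (x0, t0)) := by
      refine tendsto_nhdsWithin_iff.2 ⟨(Continuous.prodMk_right x0).tendsto t0, ?_⟩
      filter_upwards [Icc_mem_nhds ht0.1 ht0.2] with t ht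
      exact ⟨mem_univ _, ht⟩
    filter_upwards [ht.eventually hm] with t ht
    linarith
  rw [h2.deriv_eq_zero, le_antisymm h1 (norm_nonneg _), mul_zero]

/-- A semiconvex function with ascending slope near its zero level and compact superlevel set is
bounded away from zero at infinity. -/
lemma exists_le_neg_of_isCompact {u0 : Euc N → ℝ} {K C η δ0 : ℝ} (hK : 0 ≤ K) (hC : 0 ≤ C)
    (hη : 0 < η) (hδ0 : 0 < δ0) (hu : LipBound K u0) (hsc : Semiconvex C u0)
    (hsl : SlopeGE η δ0 u0) (hcpt : IsCompact {x | 0 ≤ u0 x}) :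
    ∃ m > 0, ∃ R, ∀ y, R < ‖y‖ → u0 y ≤ -m := by
  obtain ⟨R, hR⟩ := hcpt.isBounded.subset_closedBall (0 : Euc N)
  set s := min 1 (η / (C + 1)) with hs
  have hs0 : 0 < s := by positivity
  have hCs : C * s ≤ η := by
    have : (C + 1) * s ≤ η := by
      rw [mul_comm, ← le_div_iff₀ (by positivity)]; exact min_le_right _ _
    linarith
  refine ⟨min δ0 (η * s / 4), by positivity, R + 1, fun y hy => ?_⟩
  by_contra! hlt
  have hneg : u0 y < 0 := by
    by_contra! h
    have := mem_closedBall_zero_iff.1 (hR h)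
    linarith
  have hy0 : |u0 y| < δ0 := by
    rw [abs_of_neg hneg]
    linarith [min_le_left δ0 (η * s / 4)]
  obtain ⟨e, he, hd⟩ := exists_direction hC hK hη hsc hu (hsl y hy0)
    (show 0 < η * s / 4 by positivity)
  have h1 := hd s ⟨hs0.le, min_le_left _ _⟩
  have h2 : C * s ^ 2 ≤ η * s := by
    rw [pow_two, ← mul_assoc]; exact mul_le_mul_of_nonneg_right hCs hs0.le
  have h3 : 0 ≤ u0 (y + s • e) := by linarith [min_le_right δ0 (η * s / 4)]
  have h4 := mem_closedBall_zero_iff.1 (hR h3)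
  have h5 : ‖s • e‖ ≤ 1 := by
    rw [norm_smul, Real.norm_of_nonneg hs0.le]
    exact mul_le_one₀ (min_le_left _ _) (norm_nonneg _) he
  have h6 := norm_sub_le (y + s • e) (s • e)
  rw [add_sub_cancel_right] at h6
  linarith

/-- Subsolutions starting from a negative value stay negative outside a larger ball. -/
lemma le_neg_of_isSub {T C m R ρ : ℝ} (hC : 0 ≤ C) (hρ : 0 < ρ)
    (hCρ : (2 * ρ * C + 1) * T ≤ ρ ^ 2) {c v : Euc N → ℝ → ℝ} (hcC : ∀ x, ∀ t ∈ Ioo 0 T, c x t ≤ C)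
    (hv : ContinuousOn (fun p : Euc N × ℝ => v p.1 p.2) (univ ×ˢ Icc 0 T)) (hs : IsSub T c v)
    (hfar : ∀ y, R < ‖y‖ → v y 0 ≤ -m) {t : ℝ} (ht : t ∈ Ioo 0 T) {x : Euc N}
    (hx : R + ρ < ‖x‖) : v x t ≤ -m := by
  refine comparison (c := fun _ _ => C) (w2 := fun _ _ => -m) le_rfl hC hρ continuousOn_const
    (fun _ _ _ => (abs_of_nonneg hC).le) hv continuousOn_const (fun t _ x y => by simp)
    (hs.mono hcC) (isSuper_const _ _ _) (fun y hy => hfar y ?_) hCρ ht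
  rw [mem_closedBall, dist_eq_norm] at hy
  have := norm_sub_norm_le x y
  rw [norm_sub_rev] at this
  linarith

/-- The speed generated by the part of the superlevel set `{w(·, t) ≥ 0}` in a fixed ball. -/
def levelSpeed (c0 c1 : Euc N → ℝ → ℝ) (R : ℝ) (w : Euc N → ℝ → ℝ) (x : Euc N) (t : ℝ) : ℝ :=
  speed c0 c1 ({y | 0 ≤ w y t} ∩ closedBall 0 R) x t

lemma levelSpeed_eq (c0 c1 : Euc N → ℝ → ℝ) {R t : ℝ} {w : Euc N → ℝ → ℝ}
    (hw : Continuous fun y => w y t) (hR : ∀ y, R < ‖y‖ → w y t < 0) (x : Euc N) :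
    (∫ y, c0 (y - x) t * (if 0 ≤ w y t then (1 : ℝ) else 0)) + c1 x t =
      levelSpeed c0 c1 R w x t := by
  refine speed_eq c0 c1
    ((isClosed_le continuous_const hw).measurableSet.inter measurableSet_closedBall)
    (fun y => ⟨fun hy => ⟨hy, mem_closedBall_zero_iff.2 ?_⟩, fun hy => hy.1⟩) x t
  by_contra! h
  exact (hR y h).not_ge hy

lemma continuous_slice {T t : ℝ} {w : Euc N → ℝ → ℝ}
    (hw : ContinuousOn (fun p : Euc N × ℝ => w p.1 p.2) (univ ×ˢ Icc 0 T)) (ht : t ∈ Icc 0 T) :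
    Continuous fun x => w x t :=
  hw.comp_continuous (Continuous.prodMk_left t) fun _ => ⟨mem_univ _, ht⟩

/-- Uniqueness for the nonlocal equation, by iterating the dependence estimate on the speed. -/
lemma eq_of_levelSpeed {T L B Λ K M R : ℝ} {c0 c1 u v : Euc N → ℝ → ℝ}
    (hd : SpeedData T L B Λ c0 c1) (hT : 0 < T) (hK : 0 < K) (hM : 0 < M)
    (hv : ContinuousOn (fun p : Euc N × ℝ => v p.1 p.2) (univ ×ˢ Icc 0 T))
    (hu : ContinuousOn (fun p : Euc N × ℝ => u p.1 p.2) (univ ×ˢ Icc 0 T))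
    (hux : ∀ t ∈ Icc 0 T, LipBound K (fun x => u x t))
    (hband : ∀ t ∈ Icc 0 T, ∀ δ > 0,
      volume.real ({x | |u x t| ≤ δ} ∩ closedBall 0 R) ≤ M * δ)
    (hc : ContinuousOn (fun p : Euc N × ℝ => levelSpeed c0 c1 R u p.1 p.2) (univ ×ˢ Ioo 0 T))
    (hv1 : IsSub T (levelSpeed c0 c1 R v) v) (hv2 : IsSuper T (levelSpeed c0 c1 R v) v)
    (hu1 : IsSub T (levelSpeed c0 c1 R u) u) (hu2 : IsSuper T (levelSpeed c0 c1 R u) u)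
    (h0 : ∀ x, v x 0 = u x 0) (x : Euc N) {t : ℝ} (ht : t ∈ Ioo 0 T) : v x t = u x t := by
  have hB := hd.B_pos
  have hcn : ∀ (w : Euc N → ℝ → ℝ) (x : Euc N), ∀ t ∈ Ioo 0 T, 0 ≤ levelSpeed c0 c1 R w x t :=
    fun w x t ht => hd.speed_nonneg (Ioo_subset_Icc_self ht) _ x
  have hcB : ∀ (w : Euc N → ℝ → ℝ) (x : Euc N), ∀ t ∈ Ioo 0 T, levelSpeed c0 c1 R w x t ≤ 2 * B :=
    fun w x t ht => hd.speed_le (Ioo_subset_Icc_self ht) _ x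
  have key : ∀ g G : ℝ → ℝ, (∀ t, HasDerivAt G (g t) t) → Continuous g → G 0 = 0 →
      (∀ t ∈ Icc 0 T, 0 ≤ g t) →
      (∀ x, ∀ t ∈ Ioo 0 T, |levelSpeed c0 c1 R v x t - levelSpeed c0 c1 R u x t| ≤ g t) →
      ∀ x, ∀ t ∈ Ioo 0 T, |v x t - u x t| ≤ K * G t := by
    intro g G hG hg hG0 hg0 hcc x t ht
    obtain ⟨C2, hC2⟩ := isCompact_Icc.exists_bound_of_continuousOn (s := Icc 0 T) hg.continuousOn
    have hC2' : ∀ t ∈ Icc 0 T, g t ≤ C2 := fun t ht => le_of_abs_le (hC2 t ht)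
    exact abs_sub_le_of_speed_close hT hK.le (by positivity : 0 ≤ 2 * B)
      ((hg0 0 ⟨le_rfl, hT.le⟩).trans (hC2' 0 ⟨le_rfl, hT.le⟩)) hc
      (fun x t ht => by rw [abs_of_nonneg (hcn u x t ht)]; exact hcB u x t ht) hv hu hux hv1 hv2
      hu1 hu2 h0 hG hg hG0 hg0 hC2' hcc x ht
  set A := K * (2 * B * M) with hA
  set D := K * (2 * B * T) with hD
  have hDp : 0 < D := by positivity
  have hAp : 0 < A := by positivity
  have hn : ∀ n : ℕ, ∀ x, ∀ t ∈ Ioo 0 T, |v x t - u x t| ≤ D * (A ^ n * (t ^ n / n.factorial)) := by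
    intro n
    induction n with
    | zero =>
      intro x t ht
      refine (key (fun _ => 2 * B) (fun t => 2 * B * t) (fun t => ?_) continuous_const (by simp)
        (fun _ _ => by positivity) (fun x t ht => ?_) x t ht).trans ?_
      · simpa using (hasDerivAt_id t).const_mul (2 * B)
      · rw [abs_le]
        constructor <;> linarith [hcn v x t ht, hcn u x t ht, hcB v x t ht, hcB u x t ht]
      · have h1 : K * (2 * B * t) ≤ D := by
          rw [hD]; gcongr; exact ht.2.le
        simpa using h1
    | succ n ih =>
      intro x t ht
      have h1 := key (fun t => 2 * B * (M * (D * (A ^ n * (t ^ n / n.factorial)))))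
        (fun t => 2 * B * (M * (D * (A ^ n * (t ^ (n + 1) / (n + 1).factorial))))) (fun t => ?_)
        (by fun_prop) (by simp) (fun t ht => ?_) (fun x t ht => ?_) x t ht
      · refine h1.trans_eq ?_
        rw [hA]; ring
      · have h2 := (hasDerivAt_pow (n + 1) t).div_const ((n + 1).factorial : ℝ)
        have h3 := (((h2.const_mul (A ^ n)).const_mul D).const_mul M).const_mul (2 * B)
        refine h3.congr_deriv ?_
        rw [Nat.factorial_succ]
        push_cast
        have : (n.factorial : ℝ) ≠ 0 := by positivity
        have : (n + 1 : ℝ) ≠ 0 := by positivity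
        field_simp
      · have := ht.1
        positivity
      · have ht' := Ioo_subset_Icc_self ht
        have ht0 := ht.1
        refine (abs_speed_sub_le hd rfl rfl
          ((isClosed_le continuous_const (continuous_slice hv ht')).measurableSet.inter
            measurableSet_closedBall)
          ((isClosed_le continuous_const (continuous_slice hu ht')).measurableSet.inter
            measurableSet_closedBall) (fun y _ => ih y t ht) ht' x).trans ?_
        exact mul_le_mul_of_nonneg_left (hband t ht' _ (by positivity)) (by positivity)
  have hlim : Tendsto (fun n : ℕ => D * (A ^ n * (t ^ n / n.factorial))) atTop (𝓝 0) := by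
    have := (FloorSemiring.tendsto_pow_div_factorial_atTop (A * t)).const_mul D
    rw [mul_zero] at this
    refine this.congr fun n => ?_
    rw [mul_pow]; ring
  have h1 : |v x t - u x t| ≤ 0 := ge_of_tendsto' hlim fun n => hn n x t ht
  exact sub_eq_zero.1 (abs_eq_zero.1 (le_antisymm h1 (abs_nonneg _)))

namespace IsLimit

variable {T K C m R η s0 δ0 L B Λ M : ℝ} {c0 c1 : Euc N → ℝ → ℝ} {u0 : Euc N → ℝ} {l : Filter ℕ}
  {τ : ℕ → ℝ} {v : ℕ → Euc N → ℝ → ℝ} {u : Euc N → ℝ → ℝ}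

lemma continuousOn [l.NeBot] (h : IsLimit T K C m R η s0 δ0 c0 c1 u0 l τ v u) :
    ContinuousOn (fun p : Euc N × ℝ => u p.1 p.2) (univ ×ˢ Icc 0 T) := by
  rintro ⟨x, t⟩ ⟨-, ht⟩
  rw [ContinuousWithinAt, tendsto_iff_norm_sub_tendsto_zero]
  have hlim : Tendsto (fun p : Euc N × ℝ => K * ‖p.1 - x‖ + K * (C * |p.2 - t|))
      (𝓝[univ ×ˢ Icc 0 T] (x, t)) (𝓝 0) := by
    have hc : Continuous fun p : Euc N × ℝ => K * ‖p.1 - x‖ + K * (C * |p.2 - t|) := by fun_prop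
    have := hc.tendsto (x, t)
    simp only [sub_self, norm_zero, abs_zero, mul_zero, add_zero] at this
    exact this.mono_left nhdsWithin_le_nhds
  refine squeeze_zero' (Eventually.of_forall fun _ => norm_nonneg _) ?_ hlim
  filter_upwards [self_mem_nhdsWithin] with p hp
  have h1 := (h.lip hp.2).abs_le p.1 x
  have h2 := h.abs_time_le hp.2 ht x
  have h3 := abs_sub_le (u p.1 p.2) (u x p.2) (u x t)
  rw [Real.norm_eq_abs]
  linarith

lemma continuousOn_levelSpeed [l.NeBot] (h : IsLimit T K C m R η s0 δ0 c0 c1 u0 l τ v u)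
    (hd : SpeedData T L B Λ c0 c1) (hK : 0 ≤ K) (hC : 0 ≤ C) (hM : 0 ≤ M)
    (hband : ∀ t ∈ Icc 0 T, ∀ δ > 0,
      volume.real ({x | |u x t| ≤ δ} ∩ closedBall 0 R) ≤ M * δ) :
    ContinuousOn (fun p : Euc N × ℝ => levelSpeed c0 c1 R u p.1 p.2) (univ ×ˢ Icc 0 T) := by
  rintro ⟨x0, t0⟩ ⟨-, ht0⟩
  refine Metric.tendsto_nhds.2 fun ε hε => ?_
  obtain ⟨r, hr, hr'⟩ := Dislocation.exists_speed_close hd (measurableSet_superlevel (h.lip ht0))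
    hM (hband t0 ht0) x0 ht0 (half_pos hε)
  set r' := min r (r / (K * C + 1)) with hr'd
  have hr'0 : 0 < r' := by positivity
  filter_upwards [self_mem_nhdsWithin, nhdsWithin_le_nhds (closedBall_mem_nhds (x0, t0) hr'0)]
    with p hp hp'
  rw [mem_closedBall, Prod.dist_eq, max_le_iff, dist_eq_norm, Real.dist_eq] at hp'
  rw [Real.dist_eq]
  refine (hr' p.2 hp.2 (hp'.2.trans (min_le_left _ _)) p.1 (hp'.1.trans (min_le_left _ _))
    (fun y => u y p.2) (measurableSet_superlevel (h.lip hp.2)) fun y _ => ?_).trans_lt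
    (half_lt_self hε)
  refine (h.abs_time_le hp.2 ht0 y).trans ?_
  have h1 : |p.2 - t0| * (K * C + 1) ≤ r := by
    rw [← le_div_iff₀ (by positivity)]
    exact hp'.2.trans (min_le_right _ _)
  linarith [abs_nonneg (p.2 - t0)]

lemma isSub [l.NeBot] (h : IsLimit T K C m R η s0 δ0 c0 c1 u0 l τ v u)
    (hd : SpeedData T L B Λ c0 c1) (hK : 0 ≤ K) (hC : 0 ≤ C) (hM : 0 ≤ M)
    (hband : ∀ t ∈ Icc 0 T, ∀ δ > 0,
      volume.real ({x | |u x t| ≤ δ} ∩ closedBall 0 R) ≤ M * δ) :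
    IsSub T (levelSpeed c0 c1 R u) u := fun _ hφ x0 _ ht0 hm =>
  have ht0' := Ioo_subset_Icc_self ht0
  deriv_le_of_back ht0 (hd.speed_nonneg ht0' _ _)
    (fun _ hε => h.back hd hK hC hM ht0 (hband _ ht0') x0 hε) hφ hm

lemma isSuper [l.NeBot] (h : IsLimit T K C m R η s0 δ0 c0 c1 u0 l τ v u)
    (hd : SpeedData T L B Λ c0 c1) (hK : 0 ≤ K) (hC : 0 ≤ C) (hM : 0 ≤ M)
    (hband : ∀ t ∈ Icc 0 T, ∀ δ > 0,
      volume.real ({x | |u x t| ≤ δ} ∩ closedBall 0 R) ≤ M * δ) :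
    IsSuper T (levelSpeed c0 c1 R u) u := fun _ hφ x0 _ ht0 hm =>
  have ht0' := Ioo_subset_Icc_self ht0
  le_deriv_of_forward ht0 (hd.speed_nonneg ht0' _ _)
    (fun _ hε => h.forward hd hK hC hM ht0 (hband _ ht0') x0 hε) hφ hm

end IsLimit

end Dislocation

open Dislocation

/-- existence and uniqueness of the solution of the nonlocal dislocation
equation u_t = c[1_{{u(·,t) ≥ 0}}](x,t)|Du|. -/
theorem stmt12 (N : ℕ) (hN : 1 ≤ N) (T : ℝ) (hT : 0 < T)
    (c0 c1 : Euc N → ℝ → ℝ)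
    (hc0 : ContinuousOn (fun p : Euc N × ℝ => c0 p.1 p.2)
      ((Set.univ : Set (Euc N)) ×ˢ Set.Icc (0 : ℝ) T))
    (hc1 : ContinuousOn (fun p : Euc N × ℝ => c1 p.1 p.2)
      ((Set.univ : Set (Euc N)) ×ˢ Set.Icc (0 : ℝ) T))
    (L1 L1' : ℝ) (hL1 : 0 < L1) (hL1' : 0 < L1')
    (hH1c0 : ∀ x y : Euc N, ∀ t ∈ Set.Icc (0 : ℝ) T,
      |c0 x t - c0 y t| ≤ L1 * ‖x - y‖ ∧ |c0 x t| ≤ L1')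
    (hH1c1 : ∀ x y : Euc N, ∀ t ∈ Set.Icc (0 : ℝ) T,
      |c1 x t - c1 y t| ≤ L1 * ‖x - y‖ ∧ |c1 x t| ≤ L1')
    (L2 : ℝ) (hL2 : 0 < L2)
    (hH4c0 : ∀ t ∈ Set.Icc (0 : ℝ) T, Semiconvex L2 (fun x => c0 x t))
    (hH4c1 : ∀ t ∈ Set.Icc (0 : ℝ) T, Semiconvex L2 (fun x => c1 x t))
    -- (H5)
    (hc0L1 : ∀ t ∈ Set.Icc (0 : ℝ) T, Integrable (fun y => c0 y t))
    (hc0L1cont : ∀ t ∈ Set.Icc (0 : ℝ) T,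
      Tendsto (fun s => ∫ y : Euc N, |c0 y s - c0 y t|) (𝓝[Set.Icc (0 : ℝ) T] t) (𝓝 0))
    (hH5 : ∀ x : Euc N, ∀ t ∈ Set.Icc (0 : ℝ) T, (∫ y : Euc N, |c0 y t|) ≤ c1 x t)
    -- assumptions on u0
    (u0 : Euc N → ℝ) (K : ℝ≥0) (hu0 : LipschitzWith K u0)
    (hu0sc : ∃ C > (0 : ℝ), Semiconvex C u0)
    (η0 : ℝ) (hη0 : 0 < η0)
    (hH3 : ∀ x : Euc N, ∀ p ∈ SuperDiff u0 x, η0 ≤ |u0 x| + ‖p‖)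
    (hcpt : IsCompact {x : Euc N | 0 ≤ u0 x}) :
    ∃ u : Euc N → ℝ → ℝ,
      (ContinuousOn (fun p : Euc N × ℝ => u p.1 p.2)
          ((Set.univ : Set (Euc N)) ×ˢ Set.Icc (0 : ℝ) T) ∧
        IsViscositySolution N T
          (fun x t => (∫ y : Euc N, c0 (y - x) t * (if 0 ≤ u y t then (1 : ℝ) else 0)) + c1 x t)
          u u0) ∧
      ∀ v : Euc N → ℝ → ℝ,
        (ContinuousOn (fun p : Euc N × ℝ => v p.1 p.2)
            ((Set.univ : Set (Euc N)) ×ˢ Set.Icc (0 : ℝ) T) ∧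
          IsViscositySolution N T
            (fun x t => (∫ y : Euc N, c0 (y - x) t * (if 0 ≤ v y t then (1 : ℝ) else 0)) + c1 x t)
            v u0) →
        ∀ x : Euc N, ∀ t ∈ Set.Icc (0 : ℝ) T, v x t = u x t := by
  obtain ⟨C0, hC0, hsc⟩ := hu0sc
  have hd : SpeedData T L1 L1' L2 c0 c1 := ⟨hc1, hL1, hL1', hL2, hH1c0, hH1c1, hH4c0, hH4c1,
    hc0L1, hc0L1cont, hH5⟩
  have hlip : LipBound K u0 := fun x y => by
    have := hu0.dist_le_mul x y
    rw [Real.dist_eq, dist_eq_norm] at this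
    exact (le_abs_self _).trans this
  have hsl := slopeGE_of_superDiff K.2 hC0.le hη0 hlip hsc hH3
  obtain ⟨m, hm, R1, hR1⟩ := exists_le_neg_of_isCompact K.2 hC0.le (by positivity) (by positivity)
    hlip hsc hsl hcpt
  set ρ := 2 * (2 * L1') * T + T + 1 with hρ
  have hp : 0 < 2 * (2 * L1') * T := by positivity
  have hρ1 : 1 ≤ ρ := by linarith
  have hρ0 : 0 < ρ := by linarith
  have hρT : (2 * ρ * (2 * L1') + 1) * T ≤ ρ ^ 2 := by
    have h1 : ρ ^ 2 = 2 * (2 * L1') * T * ρ + (T + 1) * ρ := by rw [hρ]; ring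
    have h2 : T + 1 ≤ (T + 1) * ρ := le_mul_of_one_le_right (by positivity) hρ1
    have h3 : (2 * ρ * (2 * L1') + 1) * T = 2 * (2 * L1') * T * ρ + T := by ring
    linarith
  set R := R1 + ρ with hR
  obtain ⟨K', hK', η', hη', s0, hs0, happ⟩ := exists_approx (R := R) (m := m) hd hT K.2 hC0.le
    (by positivity) hlip hsc hsl (fun x y hx hy => hR1 y (by
      have h1 := norm_sub_norm_le x y
      rw [norm_sub_rev] at h1
      linarith))
  have hK'0 : 0 ≤ K' := le_trans K.2 hK'
  obtain ⟨a, u, hu⟩ := exists_isLimit hT happ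
  obtain ⟨M, hM, hMb⟩ := exists_band_bound N R hK'0 hη' hs0 (show 0 < η0 / 2 by positivity)
  have hband : ∀ t ∈ Icc 0 T, ∀ δ > 0,
      volume.real ({x | |u x t| ≤ δ} ∩ closedBall 0 R) ≤ M * δ := fun t ht =>
    hMb _ (hu.lip ht) fun x hx ε hε => hu.dir hK'0 ht hx hε
  have hC : 0 ≤ 2 * L1' := by positivity
  have hus := hu.isSub hd hK'0 hC hM hband
  have huS := hu.isSuper hd hK'0 hC hM hband
  have hucont := hu.continuousOn
  have hspeed : ∀ (w : Euc N → ℝ → ℝ), (∀ t ∈ Ioo 0 T, Continuous fun y => w y t) →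
      (∀ t ∈ Ioo 0 T, ∀ y, R < ‖y‖ → w y t ≤ -m) → ∀ x, ∀ t ∈ Ioo 0 T,
      (∫ y, c0 (y - x) t * (if 0 ≤ w y t then (1 : ℝ) else 0)) + c1 x t =
        levelSpeed c0 c1 R w x t := fun w hw hwR x t ht =>
    levelSpeed_eq c0 c1 (hw t ht) (fun y hy => (hwR t ht y hy).trans_lt (neg_neg_of_pos hm)) x
  have hequ := hspeed u (fun t ht => continuous_slice hucont (Ioo_subset_Icc_self ht))
    fun t ht y hy => hu.far (Ioo_subset_Icc_self ht) hy
  refine ⟨u, ⟨hucont, hu.initial hT.le, fun φ hφ x0 t0 ht0 => ?_⟩, ?_⟩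
  · exact ⟨hus.mono (fun x t ht => (hequ x t ht).ge) φ hφ x0 t0 ht0,
      huS.mono (fun x t ht => (hequ x t ht).le) φ hφ x0 t0 ht0⟩
  rintro v ⟨hvcont, hv0, hv⟩ x t ht
  have hvs : IsSub T (fun x t =>
      (∫ y, c0 (y - x) t * (if 0 ≤ v y t then (1 : ℝ) else 0)) + c1 x t) v :=
    fun φ hφ x0 t0 ht0 => (hv φ hφ x0 t0 ht0).1
  have hvS : IsSuper T (fun x t =>
      (∫ y, c0 (y - x) t * (if 0 ≤ v y t then (1 : ℝ) else 0)) + c1 x t) v :=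
    fun φ hφ x0 t0 ht0 => (hv φ hφ x0 t0 ht0).2
  have hvfar : ∀ t ∈ Ioo 0 T, ∀ y, R < ‖y‖ → v y t ≤ -m := fun t ht y hy => by
    refine le_neg_of_isSub hC hρ0 hρT (fun x t ht => ?_) hvcont hvs
      (fun y hy => (hv0 y).trans_le (hR1 y hy)) ht hy
    have ht' := Ioo_subset_Icc_self ht
    exact (speed_eq c0 c1 (A := {y | 0 ≤ v y t})
      (isClosed_le continuous_const (continuous_slice hvcont ht')).measurableSet
      (fun y => Iff.rfl) x t).trans_le (hd.speed_le ht' _ x)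
  have heqv := hspeed v (fun t ht => continuous_slice hvcont (Ioo_subset_Icc_self ht)) hvfar
  have heq : EqOn (v x) (u x) (Ioo 0 T) := fun s hs =>
    eq_of_levelSpeed (K := K' + 1) (M := M + 1) hd hT (by positivity) (by positivity) hvcont hucont
      (fun t ht => (hu.lip ht).mono (by linarith))
      (fun t ht δ hδ => (hband t ht δ hδ).trans (by gcongr; linarith))
      ((hu.continuousOn_levelSpeed hd hK'0 hC hM hband).mono (prod_mono_right Ioo_subset_Icc_self))
      (hvs.mono fun x t ht => (heqv x t ht).le) (hvS.mono fun x t ht => (heqv x t ht).ge)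
      hus huS (fun x => (hv0 x).trans (hu.initial hT.le x).symm) x hs
  have hslice : ∀ w : Euc N → ℝ → ℝ,
      ContinuousOn (fun p : Euc N × ℝ => w p.1 p.2) (univ ×ˢ Icc 0 T) →
      ContinuousOn (w x) (Icc 0 T) := fun w hw =>
    hw.comp (Continuous.prodMk_right x).continuousOn fun t ht => ⟨mem_univ _, ht⟩
  exact heq.of_subset_closure (hslice v hvcont) (hslice u hucont) Ioo_subset_Icc_self
    (closure_Ioo hT.ne).ge ht
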